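/- arXiv:2004.11552 — 16 statements merged into one kernel-verified Lean document; each statement's English description precedes it below -/
import Mathlib

section
/- Let k ≥ 2, n ≥ k, and let (F, S) be a k-out-of-n threshold padlock system with t padlocks. Then no participant's key set is contained in another participant's key set: for all distinct i, j : Fin n, ¬ (S i ⊆ S j). In particular the key sets form a Sperner family (an antichain) of subsets of Fin t. -/
/-- A `k`-out-of-`n` threshold padlock system with `t` padlocks. -/
def IsThresholdSystem (k n t : ℕ) (F : Finset (Fin t) → Prop)
    (S : Fin n → Finset (Fin t)) : Prop :=
  (∀ A B : Finset (Fin t), A ⊆ B → F A → F B) ∧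
  ∀ G : Finset (Fin n), F (G.biUnion S) ↔ k ≤ G.card

/-- In any threshold system with threshold `k ≥ 2`, no participant's key set
is contained in another participant's key set: the key sets form a Sperner
family (antichain). -/
theorem keySets_antichain (k n t : ℕ) (hk : 2 ≤ k) (hn : k ≤ n)
    (F : Finset (Fin t) → Prop) (S : Fin n → Finset (Fin t))
    (h : IsThresholdSystem k n t F S) :
    ∀ i j : Fin n, i ≠ j → ¬ S i ⊆ S j := by
  intro i j hij hsub
  obtain ⟨G, hG, hcard⟩ := Finset.exists_superset_card_eq
    (s := {i, j}) (n := k) (by rwa [Finset.card_pair hij]) (by simpa using hn)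
  have hi : i ∈ G := hG (by simp)
  have hj : j ∈ G.erase i := Finset.mem_erase.2 ⟨hij.symm, hG (by simp)⟩
  have hunion : G.biUnion S ⊆ (G.erase i).biUnion S := by
    refine Finset.biUnion_subset.2 fun x hx => ?_
    by_cases hxi : x = i
    · subst hxi
      exact hsub.trans (Finset.subset_biUnion_of_mem S hj)
    · exact Finset.subset_biUnion_of_mem S (Finset.mem_erase.2 ⟨hxi, hx⟩)
  have hle := (h.2 _).1 (h.1 _ _ hunion ((h.2 G).2 hcard.ge))
  have hlt := Finset.card_erase_lt_of_mem hi
  omega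
end

section
/- Let k ≥ 2 and n ≥ k. If there exists a k-out-of-n threshold padlock system with t padlocks, then n ≤ Nat.choose t (t / 2), i.e. the central binomial coefficient C(t, ⌊t/2⌋) is at least the number n of participants. -/
/-- In a threshold system with `2 ≤ k ≤ n`, the key sets of distinct participants are
incomparable. -/
theorem IsThresholdSystem.not_subset {k n t : ℕ} {F : Finset (Fin t) → Prop}
    {S : Fin n → Finset (Fin t)} (h : IsThresholdSystem k n t F S) (hk : 2 ≤ k) (hn : k ≤ n)
    {i j : Fin n} (hij : i ≠ j) : ¬ S i ⊆ S j := by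
  intro hsub
  obtain ⟨G, hG, hcard⟩ := Finset.exists_superset_card_eq (s := {i, j}) (n := k)
    (by rwa [Finset.card_pair hij]) (by simpa using hn)
  have hi : i ∈ G := hG (by simp)
  have hj : j ∈ G := hG (by simp)
  have hF : F ((G.erase i).biUnion S) := by
    refine h.1 _ _ (Finset.biUnion_subset.2 fun x hx => ?_) ((h.2 G).2 hcard.ge)
    by_cases hxi : x = i
    · subst hxi
      exact hsub.trans (Finset.subset_biUnion_of_mem S (Finset.mem_erase.2 ⟨hij.symm, hj⟩))
    · exact Finset.subset_biUnion_of_mem S (Finset.mem_erase.2 ⟨hxi, hx⟩)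
  have hle := (h.2 _).1 hF
  rw [Finset.card_erase_of_mem hi, hcard] at hle
  omega

/-- Sperner bound: if a `k`-out-of-`n` threshold padlock system with `t`
padlocks exists (`k ≥ 2`), then `n ≤ C(t, ⌊t/2⌋)`. -/
theorem sperner_bound (k n t : ℕ) (hk : 2 ≤ k) (hn : k ≤ n)
    (h : ∃ (F : Finset (Fin t) → Prop) (S : Fin n → Finset (Fin t)),
      IsThresholdSystem k n t F S) :
    n ≤ Nat.choose t (t / 2) := by
  obtain ⟨F, S, h⟩ := h
  have hinj : Function.Injective S := fun i j hij => by
    by_contra hne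
    exact h.not_subset hk hn hne hij.subset
  have hanti : IsAntichain (· ⊆ ·)
      (SetLike.coe (Finset.univ.map ⟨S, hinj⟩ : Finset (Finset (Fin t)))) := by
    intro A hA B hB hAB
    obtain ⟨i, -, rfl⟩ := Finset.mem_map.1 hA
    obtain ⟨j, -, rfl⟩ := Finset.mem_map.1 hB
    exact h.not_subset hk hn fun hij => hAB (congrArg S hij)
  simpa using hanti.sperner
end

section
/- Let k ≥ 3, n ≥ k, and let t ≥ 2 be even. If there exists a k-out-of-n threshold padlock system with t padlocks, then n < Nat.choose t (t / 2), i.e. the strict inequality C(t, t/2) > n holds. -/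
theorem Nat.choose_lt_middle_of_even {n r : ℕ} (hn : Even n) (hr : r ≠ n / 2) :
    n.choose r < n.choose (n / 2) := by
  have left : ∀ s, s < n / 2 → n.choose s < n.choose (n / 2) := fun s hs => by
    refine lt_of_lt_of_le ?_ (Nat.choose_le_middle (s + 1) n)
    have hpos : 0 < n.choose s := Nat.choose_pos (by omega)
    have hsub : s + 1 < n - s := by omega
    refine lt_of_mul_lt_mul_right ?_ (Nat.zero_le (s + 1))
    rw [Nat.choose_succ_right_eq]
    exact Nat.mul_lt_mul_of_pos_left hsub hpos
  obtain ⟨m, rfl⟩ := hn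
  rcases lt_or_gt_of_ne hr with h | h
  · exact left r h
  · rcases le_or_gt r (m + m) with hle | hlt
    · rw [← Nat.choose_symm hle]
      exact left _ (by omega)
    · rw [Nat.choose_eq_zero_of_lt hlt]
      exact Nat.choose_pos (by omega)

/-- Over a ground set of even size, an antichain attaining the Sperner bound is the middle layer. -/
theorem IsAntichain.eq_powersetCard_of_even {α : Type*} [Fintype α] {𝒜 : Finset (Finset α)}
    (hanti : IsAntichain (· ⊆ ·) (𝒜 : Set (Finset α))) (heven : Even (Fintype.card α))
    (hcard : (Fintype.card α).choose (Fintype.card α / 2) ≤ 𝒜.card) :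
    𝒜 = Finset.univ.powersetCard (Fintype.card α / 2) := by
  refine Finset.eq_of_subset_of_card_le (fun A hA => ?_) (by simpa using hcard)
  refine Finset.mem_powersetCard.2 ⟨Finset.subset_univ A, ?_⟩
  by_contra hne
  have hlym := Finset.lubell_yamamoto_meshalkin_inequality_sum_inv_choose (𝕜 := ℚ) hanti
  have hmid : (0 : ℚ) < (Fintype.card α).choose (Fintype.card α / 2) := by
    exact_mod_cast Nat.choose_pos (Nat.div_le_self _ _)
  have hpos : ∀ B : Finset α, (0 : ℚ) < (Fintype.card α).choose B.card := fun B => by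
    exact_mod_cast Nat.choose_pos (Finset.card_le_univ B)
  have hlt : ∑ _B ∈ 𝒜, ((Fintype.card α).choose (Fintype.card α / 2) : ℚ)⁻¹ <
      ∑ B ∈ 𝒜, ((Fintype.card α).choose B.card : ℚ)⁻¹ := by
    refine Finset.sum_lt_sum (fun B _ => ?_) ⟨A, hA, ?_⟩
    · exact inv_anti₀ (hpos B) (by exact_mod_cast Nat.choose_le_middle _ _)
    · exact inv_strictAnti₀ (hpos A) (by exact_mod_cast Nat.choose_lt_middle_of_even heven hne)
  rw [Finset.sum_const, nsmul_eq_mul] at hlt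
  have hge : (1 : ℚ) ≤ 𝒜.card * ((Fintype.card α).choose (Fintype.card α / 2) : ℚ)⁻¹ := by
    rw [← div_eq_mul_inv, one_le_div₀ hmid]
    exact_mod_cast hcard
  linarith

/-- No participant's keys are covered by those of fewer than `k` others. -/
theorem IsThresholdSystem.not_subset_biUnion {k n t : ℕ} {F : Finset (Fin t) → Prop}
    {S : Fin n → Finset (Fin t)} (h : IsThresholdSystem k n t F S) (hn : k ≤ n)
    {c : Fin n} {T : Finset (Fin n)} (hc : c ∉ T) (hT : T.card < k) :
    ¬ S c ⊆ T.biUnion S := by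
  intro hsub
  obtain ⟨G, hTG, hG⟩ := Finset.exists_superset_card_eq (s := insert c T) (n := k)
    (by rw [Finset.card_insert_of_notMem hc]; omega) (by simpa using hn)
  have hcG : c ∈ G := hTG (Finset.mem_insert_self c T)
  have hTG' : T ⊆ G.erase c := fun x hx =>
    Finset.mem_erase.2 ⟨fun e => hc (e ▸ hx), hTG (Finset.mem_insert_of_mem hx)⟩
  have hcover : G.biUnion S ⊆ (G.erase c).biUnion S := by
    rw [← Finset.insert_erase hcG, Finset.biUnion_insert, Finset.insert_erase hcG]
    exact Finset.union_subset
      (hsub.trans (Finset.biUnion_subset_biUnion_of_subset_left S hTG')) subset_rfl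
  have hk := (h.2 _).1 (h.1 _ _ hcover ((h.2 G).2 hG.ge))
  have := Finset.card_erase_lt_of_mem hcG
  omega

/-- For threshold `k ≥ 3` and an even number `t ≥ 2` of padlocks, the Sperner
bound is strict: `n < C(t, t/2)`. -/
theorem sperner_bound_strict (k n t : ℕ) (hk : 3 ≤ k) (hn : k ≤ n)
    (ht2 : 2 ≤ t) (hte : Even t)
    (h : ∃ (F : Finset (Fin t) → Prop) (S : Fin n → Finset (Fin t)),
      IsThresholdSystem k n t F S) :
    n < Nat.choose t (t / 2) := by
  obtain ⟨F, S, hS⟩ := h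
  have hsub : ∀ i j, S i ⊆ S j → i = j := fun i j hij => by
    by_contra hne
    exact hS.not_subset_biUnion hn (c := i) (T := {j}) (by simpa using hne)
      (by rw [Finset.card_singleton]; omega) (by simpa using hij)
  have hinj : Function.Injective S := fun i j hij => hsub i j hij.subset
  by_contra! hle
  have hanti : IsAntichain (· ⊆ ·) ((Finset.univ.image S : Finset _) : Set (Finset (Fin t))) := by
    intro A hA B hB hne hAB
    obtain ⟨i, -, rfl⟩ := Finset.mem_image.1 hA
    obtain ⟨j, -, rfl⟩ := Finset.mem_image.1 hB
    exact hne (congrArg S (hsub i j hAB))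
  have hcard : (Finset.univ.image S).card = n := by
    simp [Finset.card_image_of_injective _ hinj]
  have hmid := hanti.eq_powersetCard_of_even (by simpa using hte) (by simpa [hcard] using hle)
  rw [Fintype.card_fin] at hmid
  have hsurj : ∀ A : Finset (Fin t), A.card = t / 2 → ∃ i, S i = A := fun A hA => by
    have : A ∈ Finset.univ.image S := by simp [hmid, hA]
    simpa using this
  have ht4 : 4 ≤ t := by
    by_contra! hlt
    obtain rfl : t = 2 := by
      obtain ⟨m, rfl⟩ := hte
      omega
    rw [hmid] at hcard
    simp at hcard
    omega
  obtain ⟨C, -, hC⟩ := Finset.exists_subset_card_eq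
    (s := (Finset.univ : Finset (Fin t))) (n := t / 2) (by simp; omega)
  obtain ⟨x, hx, x', hx', hxx'⟩ := Finset.one_lt_card.1 (show 1 < C.card by omega)
  obtain ⟨y, hy⟩ : ∃ y, y ∉ C := by
    by_contra! hall
    have := Finset.card_le_card (show Finset.univ ⊆ C from fun z _ => hall z)
    rw [Finset.card_univ, Fintype.card_fin] at this
    omega
  have hswap : ∀ z ∈ C, (insert y (C.erase z)).card = t / 2 := fun z hz => by
    rw [Finset.card_insert_of_notMem (fun hm => hy (Finset.mem_of_mem_erase hm)),
      Finset.card_erase_of_mem hz]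
    omega
  obtain ⟨c, hc⟩ := hsurj C hC
  obtain ⟨a, ha⟩ := hsurj _ (hswap x hx)
  obtain ⟨b, hb⟩ := hsurj _ (hswap x' hx')
  refine hS.not_subset_biUnion hn (c := c) (T := {a, b}) ?_
    (Finset.card_le_two.trans_lt (by omega)) ?_
  · intro hmem
    refine hy (hc ▸ ?_)
    rcases Finset.mem_insert.1 hmem with rfl | hmem
    · simp [ha]
    · simp [Finset.mem_singleton.1 hmem, hb]
  · intro z hz
    rw [hc] at hz
    simp only [Finset.mem_biUnion, Finset.mem_insert, Finset.mem_singleton, exists_eq_or_imp,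
      exists_eq_left, ha, hb, Finset.mem_erase]
    grind
end

section
/- Every 2-out-of-3 threshold padlock system has at least 3 padlocks, and for every n ≥ 4, every 2-out-of-n threshold padlock system has at least 4 padlocks. -/
namespace IsThresholdSystem

variable {n t : ℕ} {F : Finset (Fin t) → Prop} {S : Fin n → Finset (Fin t)}

theorem eq_of_subset (h : IsThresholdSystem 2 n t F S) {i j : Fin n} (hij : S i ⊆ S j) :
    i = j := by
  by_contra hne
  have hpair : F (({i, j} : Finset (Fin n)).biUnion S) :=
    (h.2 _).2 (Finset.card_pair hne).ge
  have hsub : ({i, j} : Finset (Fin n)).biUnion S ⊆ ({j} : Finset (Fin n)).biUnion S := by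
    simp [Finset.biUnion_insert, Finset.union_subset_iff, hij]
  simpa using (h.2 _).1 (h.1 _ _ hsub hpair)

/-- Sperner's theorem bounds the number of participants in a `2`-out-of-`n` system. -/
theorem le_choose (h : IsThresholdSystem 2 n t F S) : n ≤ t.choose (t / 2) := by
  have hinj : Function.Injective S := fun _ _ hij => h.eq_of_subset hij.subset
  have hanti : IsAntichain (· ⊆ ·)
      (Finset.univ.image S : Set (Finset (Fin t))) := by
    intro A hA B hB hAB hsub
    obtain ⟨i, -, rfl⟩ := Finset.mem_image.1 (Finset.mem_coe.1 hA)
    obtain ⟨j, -, rfl⟩ := Finset.mem_image.1 (Finset.mem_coe.1 hB)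
    exact hAB (congrArg S (h.eq_of_subset hsub))
  simpa [Finset.card_image_of_injective _ hinj] using hanti.sperner

end IsThresholdSystem

/-- Every `2`-out-of-`3` threshold padlock system has at least `3` padlocks
and, for `n ≥ 4`, every `2`-out-of-`n` system has at least `4` padlocks. -/
theorem two_threshold_lower_bounds :
    (∀ (t : ℕ) (F : Finset (Fin t) → Prop) (S : Fin 3 → Finset (Fin t)),
      IsThresholdSystem 2 3 t F S → 3 ≤ t) ∧
    (∀ n, 4 ≤ n → ∀ (t : ℕ) (F : Finset (Fin t) → Prop)
      (S : Fin n → Finset (Fin t)),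
      IsThresholdSystem 2 n t F S → 4 ≤ t) := by
  refine ⟨fun t F S h => ?_, fun n hn t F S h => ?_⟩
  all_goals
    have hle := h.le_choose
    by_contra! ht
    interval_cases t <;> simp at hle <;> omega
end

section
/- For all k, n with 2 ≤ k ≤ n ≤ 5 and (k, n) ≠ (2, 5), the minimal number of padlocks satisfies ℓ(k, n) = n. Moreover ℓ(2, 5) = 4, ℓ(2, 6) = 4, and ℓ(2, n) = 5 for every n with 7 ≤ n ≤ 10. -/
/-- `ℓ(k, n)`: the minimal number of padlocks in any `k`-out-of-`n`
threshold padlock system. -/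
noncomputable def padlockNumber (k n : ℕ) : ℕ :=
  sInf {t | ∃ (F : Finset (Fin t) → Prop) (S : Fin n → Finset (Fin t)),
    IsThresholdSystem k n t F S}

open Finset

/-- A family with no member covered by `r` others, on fewer than `(r + 2).choose 2` points,
has at most as many members as points. -/
theorem card_le_card_of_coverFree {ι α : Type*} [DecidableEq ι] [DecidableEq α] (r : ℕ) :
    ∀ (I : Finset ι) (T : Finset α) (S : ι → Finset α), (∀ i ∈ I, S i ⊆ T) →
      (∀ i ∈ I, ∀ H ⊆ I, i ∉ H → #H ≤ r → ¬ S i ⊆ H.biUnion S) →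
      #T < (r + 2).choose 2 → #I ≤ #T := by
  induction r with
  | zero =>
    intro I T S hT hS hlt
    have hT0 : T = ∅ := by simpa using hlt
    subst hT0
    rcases I.eq_empty_or_nonempty with rfl | ⟨i, hi⟩
    · simp
    · exact absurd ((hT i hi).trans (empty_subset _))
        (hS i hi ∅ (empty_subset _) (notMem_empty _) le_rfl)
  | succ r ih =>
    intro I T S hT hS hlt
    by_cases hp : ∀ i ∈ I, ∃ a ∈ S i, ∀ j ∈ I, j ≠ i → a ∉ S j
    · rcases I.eq_empty_or_nonempty with rfl | ⟨i₀, hi₀⟩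
      · simp
      have : Nonempty α := ⟨(hp i₀ hi₀).choose⟩
      choose! f hf hf' using hp
      refine card_le_card_of_injOn f (fun i hi => hT i hi (hf i hi)) ?_
      intro i hi j hj hij
      by_contra hne
      exact hf' i hi j hj (Ne.symm hne) (hij ▸ hf j hj)
    · push Not at hp
      obtain ⟨x, hx, hx'⟩ := hp
      have : Nonempty ι := ⟨x⟩
      choose! g hg hgx hag using hx'
      have hcard : r + 2 ≤ #(S x) := by
        by_contra hlt'
        refine hS x hx ((S x).image g) ?_ ?_ (card_image_le.trans (by omega)) ?_
        · exact image_subset_iff.2 hg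
        · intro hmem
          obtain ⟨a, ha, hax⟩ := mem_image.1 hmem
          exact hgx a ha hax
        · intro a ha
          exact mem_biUnion.2 ⟨g a, mem_image_of_mem g ha, hag a ha⟩
      have hdiff := card_sdiff_add_card_eq_card (hT x hx)
      have hchoose : (r + 1 + 2).choose 2 = (r + 2) + (r + 2).choose 2 := by
        rw [Nat.choose_succ_succ' (r + 2) 1, Nat.choose_one_right]
      have := ih (I.erase x) (T \ S x) (fun i => S i \ S x)
        (fun i hi => sdiff_subset_sdiff (hT i (mem_of_mem_erase hi)) Subset.rfl)
        (by
          intro i hi H hH hiH hHr hsub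
          refine hS i (mem_of_mem_erase hi) (insert x H)
            (insert_subset hx (hH.trans (erase_subset _ _))) ?_
            ((card_insert_le _ _).trans (by omega)) ?_
          · simp [ne_of_mem_erase hi, hiH]
          · intro a ha
            by_cases hax : a ∈ S x
            · exact mem_biUnion.2 ⟨x, mem_insert_self _ _, hax⟩
            · obtain ⟨j, hj, haj⟩ := mem_biUnion.1 (hsub (mem_sdiff.2 ⟨ha, hax⟩))
              exact mem_biUnion.2 ⟨j, mem_insert_of_mem hj, (mem_sdiff.1 haj).1⟩)
        (by omega)
      have := card_erase_add_one hx
      omega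

theorem IsThresholdSystem.not_subset_biUnion_s5 {k n t : ℕ} {F : Finset (Fin t) → Prop}
    {S : Fin n → Finset (Fin t)} (h : IsThresholdSystem k n t F S) (hkn : k ≤ n)
    {i : Fin n} {H : Finset (Fin n)} (hi : i ∉ H) (hH : #H + 1 ≤ k) :
    ¬ S i ⊆ H.biUnion S := by
  intro hsub
  obtain ⟨K, hHK, hK, hKcard⟩ := exists_subsuperset_card_eq (s := H) (t := univ.erase i)
    (n := k - 1) (fun j hj => mem_erase.2 ⟨fun e => hi (e ▸ hj), mem_univ j⟩) (by omega)
    (by rw [card_erase_of_mem (mem_univ i), card_univ, Fintype.card_fin]; omega)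
  have hiK : i ∉ K := fun hmem => ne_of_mem_erase (hK hmem) rfl
  have hF : F ((insert i K).biUnion S) := (h.2 _).2 (by rw [card_insert_of_notMem hiK]; omega)
  rw [biUnion_insert, union_eq_right.2 (hsub.trans (biUnion_subset_biUnion_of_subset_left S hHK)),
    h.2] at hF
  omega

theorem IsThresholdSystem.le_of_lt_choose {k n t : ℕ} {F : Finset (Fin t) → Prop}
    {S : Fin n → Finset (Fin t)} (h : IsThresholdSystem k n t F S) (hk : 1 ≤ k) (hkn : k ≤ n)
    (ht : t < (k + 1).choose 2) : n ≤ t := by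
  obtain ⟨r, rfl⟩ := Nat.exists_eq_add_of_le' hk
  simpa using card_le_card_of_coverFree r univ univ S (fun i _ => subset_univ _)
    (fun i _ H _ hi hH => h.not_subset_biUnion_s5 hkn hi (by omega)) (by simpa using ht)

theorem IsThresholdSystem.le_centralChoose {n t : ℕ} {F : Finset (Fin t) → Prop}
    {S : Fin n → Finset (Fin t)} (h : IsThresholdSystem 2 n t F S) (hn : 2 ≤ n) :
    n ≤ t.choose (t / 2) := by
  have hS : ∀ i j, i ≠ j → ¬ S i ⊆ S j := fun i j hij => by
    simpa using h.not_subset_biUnion_s5 hn (i := i) (H := {j}) (by simpa using hij) (by simp)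
  have hinj : Function.Injective S := fun i j hij => by
    by_contra hne
    exact hS i j hne hij.subset
  have hanti : IsAntichain (· ⊆ ·) ((univ.image S : Finset (Finset (Fin t))) :
      Set (Finset (Fin t))) := by
    intro A hA B hB hAB
    obtain ⟨i, -, rfl⟩ := mem_image.1 hA
    obtain ⟨j, -, rfl⟩ := mem_image.1 hB
    exact hS i j (fun e => hAB (e ▸ rfl))
  simpa [card_image_of_injective _ hinj] using hanti.sperner

theorem isThresholdSystem_singleton (k n : ℕ) :
    IsThresholdSystem k n n (fun A => k ≤ #A) (fun i => {i}) :=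
  ⟨fun _ _ hAB hA => hA.trans (card_le_card hAB), fun G => by rw [biUnion_singleton_eq_self]⟩

theorem exists_isThresholdSystem_two {n t m : ℕ} (h : n ≤ t.choose m) :
    ∃ (F : Finset (Fin t) → Prop) (S : Fin n → Finset (Fin t)), IsThresholdSystem 2 n t F S := by
  obtain ⟨S⟩ : Nonempty (Fin n ↪ powersetCard m (univ : Finset (Fin t))) :=
    Function.Embedding.nonempty_of_card_le (by simpa using h)
  have hcard : ∀ i, #(S i).1 = m := fun i => (mem_powersetCard.1 (S i).2).2
  refine ⟨fun A => m < #A, fun i => (S i).1,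
    fun _ _ hAB hA => hA.trans_le (card_le_card hAB), fun G => ⟨fun hG => ?_, fun hG => ?_⟩⟩
  · by_contra hlt
    have := card_biUnion_le_card_mul G (fun i => (S i).1) m (fun i _ => (hcard i).le)
    have : #G * m ≤ 1 * m := Nat.mul_le_mul_right m (by omega)
    omega
  · obtain ⟨i, hi, j, hj, hij⟩ := one_lt_card.1 hG
    by_contra hle
    have heq : ∀ l ∈ G, (S l).1 = G.biUnion fun i => (S i).1 := fun l hl =>
      eq_of_subset_of_card_le (subset_biUnion_of_mem (fun i => (S i).1) hl)
        (by rw [hcard]; exact not_lt.1 hle)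
    exact hij (S.injective (Subtype.ext ((heq i hi).trans (heq j hj).symm)))

theorem padlockNumber_eq {k n t : ℕ}
    (hex : ∃ (F : Finset (Fin t) → Prop) (S : Fin n → Finset (Fin t)), IsThresholdSystem k n t F S)
    (hle : ∀ (s : ℕ) (F : Finset (Fin s) → Prop) (S : Fin n → Finset (Fin s)),
      IsThresholdSystem k n s F S → t ≤ s) : padlockNumber k n = t :=
  IsLeast.csInf_eq ⟨hex, fun s ⟨F, S, h⟩ => hle s F S h⟩

theorem padlockNumber_two_eq {n t : ℕ} (hn : 2 ≤ n) (hnt : n ≤ t.choose (t / 2))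
    (hlt : ∀ s < t, s.choose (s / 2) < n) : padlockNumber 2 n = t :=
  padlockNumber_eq (exists_isThresholdSystem_two hnt) fun s _ _ h => by
    by_contra hs
    exact (hlt s (not_le.1 hs)).not_ge (h.le_centralChoose hn)

theorem padlockNumber_eq_self {k n : ℕ} (hk : 1 ≤ k) (hkn : k ≤ n)
    (hn : n ≤ (k + 1).choose 2) : padlockNumber k n = n :=
  padlockNumber_eq ⟨_, _, isThresholdSystem_singleton k n⟩ fun s _ _ h => by
    by_contra hs
    exact hs (h.le_of_lt_choose hk hkn (by omega))

/-- Small cases: `ℓ(k, n) = n` for all `2 ≤ k ≤ n ≤ 5` except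
`ℓ(2, 5) = 4`; also `ℓ(2, 6) = 4` and `ℓ(2, n) = 5` for `7 ≤ n ≤ 10`. -/
theorem small_cases :
    (∀ k n : ℕ, 2 ≤ k → k ≤ n → n ≤ 5 → ¬(k = 2 ∧ n = 5) →
      padlockNumber k n = n) ∧
    padlockNumber 2 5 = 4 ∧
    padlockNumber 2 6 = 4 ∧
    (∀ n : ℕ, 7 ≤ n → n ≤ 10 → padlockNumber 2 n = 5) := by
  refine ⟨fun k n hk hkn hn hne => ?_, padlockNumber_two_eq (by decide) (by decide) (by decide),
    padlockNumber_two_eq (by decide) (by decide) (by decide), fun n h7 h10 => ?_⟩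
  · by_cases h24 : k = 2 ∧ n = 4
    · obtain ⟨rfl, rfl⟩ := h24
      exact padlockNumber_two_eq (by decide) (by decide) (by decide)
    · refine padlockNumber_eq_self (by omega) hkn ?_
      have hk5 : k ≤ 5 := hkn.trans hn
      interval_cases k <;> simp [Nat.choose] <;> omega
  · interval_cases n <;>
      exact padlockNumber_two_eq (by decide) (by decide) (by decide)
end

section
/- For every n ≥ 2 there exists a 2-out-of-n threshold padlock system with t = 2 · ⌈log₂ n⌉ padlocks (where ⌈log₂ n⌉ = Nat.clog 2 n). In particular ℓ(2, n) ≤ 2⌈log₂ n⌉. -/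
/-- The keys of participant `i` in the binary scheme: padlock `j` asks for the value `j % 2` of the
`j / 2`-th binary digit of `i`. -/
def binaryKeys (n m : ℕ) (i : Fin n) : Finset (Fin (2 * m)) :=
  {j | (i : ℕ).testBit (j / 2) = decide ((j : ℕ) % 2 = 1)}

/-- The door opens when both padlocks belonging to some binary digit are open. -/
def ContainsDigitPair {m : ℕ} (A : Finset (Fin (2 * m))) : Prop :=
  ∃ x ∈ A, ∃ y ∈ A, x ≠ y ∧ (x : ℕ) / 2 = y / 2

theorem mem_binaryKeys {n m : ℕ} {i : Fin n} {j : Fin (2 * m)} :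
    j ∈ binaryKeys n m i ↔ (i : ℕ).testBit (j / 2) = decide ((j : ℕ) % 2 = 1) := by
  simp [binaryKeys]

theorem eq_of_mem_binaryKeys {n m : ℕ} {i : Fin n} {x y : Fin (2 * m)}
    (hx : x ∈ binaryKeys n m i) (hy : y ∈ binaryKeys n m i) (hxy : (x : ℕ) / 2 = y / 2) :
    x = y := by
  rw [mem_binaryKeys] at hx hy
  rw [hxy, hy, decide_eq_decide] at hx
  ext
  omega

theorem exists_mem_binaryKeys {n m b : ℕ} (i : Fin n) (hb : b < m) :
    ∃ x ∈ binaryKeys n m i, (x : ℕ) = 2 * b + ((i : ℕ).testBit b).toNat := by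
  have hlt := Bool.toNat_lt ((i : ℕ).testBit b)
  refine ⟨⟨2 * b + ((i : ℕ).testBit b).toNat, by omega⟩, ?_, rfl⟩
  rw [mem_binaryKeys]
  have hdiv : (2 * b + ((i : ℕ).testBit b).toNat) / 2 = b := by omega
  have hmod (c : Bool) : c = decide ((2 * b + c.toNat) % 2 = 1) := by cases c <;> simp
  simpa only [hdiv] using hmod _

theorem exists_testBit_ne_of_lt_two_pow {a b m : ℕ} (ha : a < 2 ^ m) (hb : b < 2 ^ m)
    (hab : a ≠ b) : ∃ k < m, a.testBit k ≠ b.testBit k := by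
  obtain ⟨k, hk⟩ := Nat.exists_testBit_ne_of_ne hab
  refine ⟨k, ?_, hk⟩
  by_contra! hmk
  have hpow : 2 ^ m ≤ 2 ^ k := Nat.pow_le_pow_right two_pos hmk
  exact hk (by rw [Nat.testBit_lt_two_pow (ha.trans_le hpow),
    Nat.testBit_lt_two_pow (hb.trans_le hpow)])

theorem isThresholdSystem_binaryKeys {n m : ℕ} (h : n ≤ 2 ^ m) :
    IsThresholdSystem 2 n (2 * m) ContainsDigitPair (binaryKeys n m) := by
  refine ⟨fun A B hAB ⟨x, hx, y, hy, hxy⟩ => ⟨x, hAB hx, y, hAB hy, hxy⟩, fun G => ?_⟩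
  rw [Nat.succ_le_iff, Finset.one_lt_card]
  constructor
  · rintro ⟨x, hx, y, hy, hne, hxy⟩
    obtain ⟨i, hi, hxi⟩ := Finset.mem_biUnion.1 hx
    obtain ⟨j, hj, hyj⟩ := Finset.mem_biUnion.1 hy
    refine ⟨i, hi, j, hj, ?_⟩
    rintro rfl
    exact hne (eq_of_mem_binaryKeys hxi hyj hxy)
  · rintro ⟨i, hi, j, hj, hij⟩
    obtain ⟨b, hb, hbit⟩ := exists_testBit_ne_of_lt_two_pow (i.2.trans_le h) (j.2.trans_le h)
      (Fin.val_ne_of_ne hij)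
    obtain ⟨x, hx, hxv⟩ := exists_mem_binaryKeys i hb
    obtain ⟨y, hy, hyv⟩ := exists_mem_binaryKeys j hb
    have hxlt := Bool.toNat_lt ((i : ℕ).testBit b)
    have hylt := Bool.toNat_lt ((j : ℕ).testBit b)
    refine ⟨x, Finset.mem_biUnion.2 ⟨i, hi, hx⟩, y, Finset.mem_biUnion.2 ⟨j, hj, hy⟩, ?_, by omega⟩
    rintro rfl
    exact hbit (Function.LeftInverse.injective Bool.ofNat_toNat (by omega))

/-- For `n ≥ 2` there is a `2`-out-of-`n` threshold padlock system with
`2⌈log₂ n⌉` padlocks; in particular `ℓ(2, n) ≤ 2⌈log₂ n⌉`. -/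
theorem two_threshold_log_upper (n : ℕ) (hn : 2 ≤ n) :
    (∃ (F : Finset (Fin (2 * Nat.clog 2 n)) → Prop)
      (S : Fin n → Finset (Fin (2 * Nat.clog 2 n))),
      IsThresholdSystem 2 n (2 * Nat.clog 2 n) F S) ∧
    padlockNumber 2 n ≤ 2 * Nat.clog 2 n := by
  have h := isThresholdSystem_binaryKeys (Nat.le_pow_clog one_lt_two n)
  exact ⟨⟨_, _, h⟩, Nat.sInf_le ⟨_, _, h⟩⟩
end

section
/- Let B be a family of 3-element finsets (triads) of a type α such that any two distinct members of B intersect in at most one element (equivalently, every pair of elements is contained in at most one member of B). Then for any pairwise distinct triads b₁, b₂, b₃ ∈ B and any triads c₁, c₂ ∈ B, the union b₁ ∪ b₂ ∪ b₃ is not contained in c₁ ∪ c₂. -/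
/-- A triad of a partial Steiner triple system that is covered by two triads of the system
is one of them. -/
theorem eq_or_eq_of_subset_union_of_packing {α : Type*} [DecidableEq α] {B : Set (Finset α)}
    (hcard : ∀ b ∈ B, b.card = 3)
    (hpack : ∀ b ∈ B, ∀ b' ∈ B, b ≠ b' → (b ∩ b').card ≤ 1)
    {b c₁ c₂ : Finset α} (hb : b ∈ B) (hc₁ : c₁ ∈ B) (hc₂ : c₂ ∈ B) (h : b ⊆ c₁ ∪ c₂) :
    b = c₁ ∨ b = c₂ := by
  by_contra! hne
  have hunion : (b ∩ c₁) ∪ (b ∩ c₂) = b := by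
    rw [← Finset.inter_union_distrib_left, Finset.inter_eq_left.mpr h]
  have hle := Finset.card_union_le (b ∩ c₁) (b ∩ c₂)
  rw [hunion, hcard b hb] at hle
  have h₁ := hpack b hb c₁ hc₁ hne.1
  have h₂ := hpack b hb c₂ hc₂ hne.2
  omega

/-- In a partial Steiner triple system (a family of triads any two of which
share at most one element), the union of three pairwise distinct triads is
never contained in the union of two triads. -/
theorem steiner_three_not_in_two {α : Type*} [DecidableEq α]
    (B : Set (Finset α))
    (hcard : ∀ b ∈ B, b.card = 3)
    (hpack : ∀ b ∈ B, ∀ b' ∈ B, b ≠ b' → (b ∩ b').card ≤ 1)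
    (b₁ b₂ b₃ : Finset α) (hb₁ : b₁ ∈ B) (hb₂ : b₂ ∈ B) (hb₃ : b₃ ∈ B)
    (h12 : b₁ ≠ b₂) (h13 : b₁ ≠ b₃) (h23 : b₂ ≠ b₃)
    (c₁ c₂ : Finset α) (hc₁ : c₁ ∈ B) (hc₂ : c₂ ∈ B) :
    ¬ b₁ ∪ b₂ ∪ b₃ ⊆ c₁ ∪ c₂ := by
  intro h
  obtain ⟨h', h₃⟩ := Finset.union_subset_iff.mp h
  obtain ⟨h₁, h₂⟩ := Finset.union_subset_iff.mp h'
  have e₁ := eq_or_eq_of_subset_union_of_packing hcard hpack hb₁ hc₁ hc₂ h₁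
  have e₂ := eq_or_eq_of_subset_union_of_packing hcard hpack hb₂ hc₁ hc₂ h₂
  have e₃ := eq_or_eq_of_subset_union_of_packing hcard hpack hb₃ hc₁ hc₂ h₃
  grind
end

section
/- Let t, n be natural numbers and let B : Fin n → Finset (Fin t) be an injective assignment of triads such that each B i has cardinality 3 and any two distinct triads B i, B j intersect in at most one element. Then there exists a 3-out-of-n threshold padlock system with t padlocks whose key assignment is S = B. In other words, any (partial) Steiner triad system gives rise to a 3-threshold system. -/
/-- A finset meeting each of the sets `f h`, `h ∈ H`, in at most one point and covered by their
union has at most `H.card` elements. -/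
theorem Finset.card_le_card_of_subset_biUnion_of_card_inter_le_one {ι α : Type*} [DecidableEq α]
    {s : Finset α} {H : Finset ι} {f : ι → Finset α} (hs : s ⊆ H.biUnion f)
    (hf : ∀ h ∈ H, (s ∩ f h).card ≤ 1) : s.card ≤ H.card := by
  have hcover : s = H.biUnion fun h => s ∩ f h := by
    rw [← Finset.inter_biUnion, Finset.inter_eq_left.mpr hs]
  rw [hcover]
  simpa using Finset.card_biUnion_le_card_mul H (fun h => s ∩ f h) 1 hf

/-- Any (partial) Steiner triad system gives rise to a `3`-threshold system:
if the injective key assignment `B` consists of triads pairwise intersecting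
in at most one element, then some monotone family `F` makes `(F, B)` a
`3`-out-of-`n` threshold padlock system. -/
theorem steiner_gives_three_threshold (t n : ℕ)
    (B : Fin n → Finset (Fin t)) (hinj : Function.Injective B)
    (hcard : ∀ i, (B i).card = 3)
    (hpack : ∀ i j, i ≠ j → (B i ∩ B j).card ≤ 1) :
    ∃ F : Finset (Fin t) → Prop, IsThresholdSystem 3 n t F B := by
  refine ⟨fun A => ∃ G : Finset (Fin n), 3 ≤ G.card ∧ G.biUnion B ⊆ A, ?_, fun H => ⟨?_, ?_⟩⟩
  · rintro A A' hA ⟨G, hG, hGA⟩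
    exact ⟨G, hG, hGA.trans hA⟩
  · rintro ⟨G, hG, hGH⟩
    by_contra! hH
    obtain ⟨g, hgG, hgH⟩ := Finset.exists_mem_notMem_of_card_lt_card (hH.trans_le hG)
    have hle := Finset.card_le_card_of_subset_biUnion_of_card_inter_le_one
      ((Finset.subset_biUnion_of_mem B hgG).trans hGH)
      fun h hh => hpack g h fun hgh => hgH (hgh ▸ hh)
    rw [hcard g] at hle
    omega
  · exact fun hH => ⟨H, hH, subset_rfl⟩
end

section
/- For every natural number v ≥ 1 and every n with 3 ≤ n ≤ (2v + 1)(3v + 1), there exists a 3-out-of-n threshold padlock system with t = 6v + 3 padlocks. Consequently ℓ(3, n) = O(√n). -/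
/-- In a partial linear space with blocks of size three, a block covered by two blocks is one of
them. -/
theorem eq_or_eq_of_subset_union {ι P : Type*} [DecidableEq P] {B : ι → Finset P}
    (hcard : ∀ i, (B i).card = 3) (hlin : ∀ i j, 1 < (B i ∩ B j).card → i = j)
    {a b c : ι} (h : B c ⊆ B a ∪ B b) : c = a ∨ c = b := by
  have h1 : (B c).card ≤ (B c ∩ B a).card + (B c ∩ B b).card := by
    refine le_trans (le_of_eq ?_) (Finset.card_union_le _ _)
    rw [← Finset.inter_union_distrib_left, Finset.inter_eq_left.mpr h]
  rw [hcard] at h1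
  have : 1 < (B c ∩ B a).card ∨ 1 < (B c ∩ B b).card := by omega
  exact this.imp (hlin _ _) (hlin _ _)

/-- If no key set is covered by two others, the system freed by every set of padlocks not covered
by two key sets is a `3`-out-of-`n` threshold system. -/
theorem isThresholdSystem_three {n t : ℕ} [NeZero n] {S : Fin n → Finset (Fin t)}
    (hS : ∀ a b c, S c ⊆ S a ∪ S b → c = a ∨ c = b) :
    IsThresholdSystem 3 n t (fun X => ∀ a b, ¬ X ⊆ S a ∪ S b) S := by
  refine ⟨fun A B hAB hA a b h => hA a b (hAB.trans h), fun G => ⟨fun h => ?_, ?_⟩⟩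
  · by_contra hG
    obtain ⟨a, b, hab⟩ : ∃ a b, G ⊆ {a, b} := by
      have hG' : G.card = 0 ∨ G.card = 1 ∨ G.card = 2 := by omega
      rcases hG' with h0 | h1 | h2
      · exact ⟨0, 0, by simp [Finset.card_eq_zero.mp h0]⟩
      · obtain ⟨a, rfl⟩ := Finset.card_eq_one.mp h1
        exact ⟨a, a, by simp⟩
      · obtain ⟨a, b, -, rfl⟩ := Finset.card_eq_two.mp h2
        exact ⟨a, b, subset_rfl⟩
    refine h a b ((Finset.biUnion_subset_biUnion_of_subset_left S hab).trans ?_)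
    simp [Finset.biUnion_insert]
  · intro hG a b h
    have hab : G ⊆ {a, b} := fun c hc => by
      simpa using hS a b c ((Finset.subset_biUnion_of_mem S hc).trans h)
    have := (Finset.card_le_card hab).trans Finset.card_le_two
    omega

/-- A partial linear space on `t` points with at least `n` blocks, all of size three, yields a
`3`-out-of-`n` threshold system with `t` padlocks. -/
theorem exists_isThresholdSystem_three {ι P : Type*} [Fintype ι] [Fintype P] [DecidableEq P]
    {n t : ℕ} [NeZero n] (hn : n ≤ Fintype.card ι) (ht : Fintype.card P = t) {B : ι → Finset P}
    (hcard : ∀ i, (B i).card = 3) (hlin : ∀ i j, 1 < (B i ∩ B j).card → i = j) :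
    ∃ (F : Finset (Fin t) → Prop) (S : Fin n → Finset (Fin t)), IsThresholdSystem 3 n t F S := by
  obtain ⟨f⟩ : Nonempty (Fin n ↪ ι) :=
    Function.Embedding.nonempty_of_card_le (by simpa using hn)
  let e : P ≃ Fin t := Fintype.equivFinOfCardEq ht
  refine ⟨_, fun i => (B (f i)).map e.toEmbedding, isThresholdSystem_three fun a b c h => ?_⟩
  rw [← Finset.map_union, Finset.map_subset_map] at h
  exact (eq_or_eq_of_subset_union hcard hlin h).imp (f.injective ·) (f.injective ·)

/-- The blocks of the Bose triple system on `ZMod (2 * v + 1) × ZMod 3`. A mixed block is indexed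
by the midpoint `m` and the half-difference `d + 1` of its two points on level `i`. -/
def boseBlock (v : ℕ) :
    ZMod (2 * v + 1) × Option (Fin v × ZMod 3) → Finset (ZMod (2 * v + 1) × ZMod 3)
  | (m, none) => {(m, 0), (m, 1), (m, 2)}
  | (m, some (d, i)) => {(m - ((d + 1 : ℕ) : ZMod (2 * v + 1)), i),
      (m + ((d + 1 : ℕ) : ZMod (2 * v + 1)), i), (m, i + 1)}

theorem ZMod.natCast_ne_zero_of_pos_of_lt {n k : ℕ} (h0 : 0 < k) (hk : k < n) :
    (k : ZMod n) ≠ 0 := by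
  rw [Ne, ZMod.natCast_eq_zero_iff]
  exact Nat.not_dvd_of_pos_of_lt h0 hk

theorem ZMod.eq_zero_of_add_self_eq_zero {v : ℕ} {x : ZMod (2 * v + 1)} (h : x + x = 0) :
    x = 0 := by
  have h2 : (2 * v + 1 : ZMod (2 * v + 1)) = 0 := by
    exact_mod_cast ZMod.natCast_self (2 * v + 1)
  linear_combination x * h2 - v * h

theorem half_cast_ne_zero {v : ℕ} (d : Fin v) : ((d + 1 : ℕ) : ZMod (2 * v + 1)) ≠ 0 :=
  ZMod.natCast_ne_zero_of_pos_of_lt (by omega) (by omega)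

theorem half_cast_add_ne_zero {v : ℕ} (d d' : Fin v) :
    ((d + 1 : ℕ) : ZMod (2 * v + 1)) + ((d' + 1 : ℕ) : ZMod (2 * v + 1)) ≠ 0 := by
  rw [← Nat.cast_add]
  exact ZMod.natCast_ne_zero_of_pos_of_lt (by omega) (by omega)

theorem half_cast_injective {v : ℕ} {d d' : Fin v}
    (h : ((d + 1 : ℕ) : ZMod (2 * v + 1)) = ((d' + 1 : ℕ) : ZMod (2 * v + 1))) : d = d' := by
  rw [ZMod.natCast_eq_natCast_iff', Nat.mod_eq_of_lt (by omega), Nat.mod_eq_of_lt (by omega)] at h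
  omega

theorem card_boseBlock {v : ℕ} (b : ZMod (2 * v + 1) × Option (Fin v × ZMod 3)) :
    (boseBlock v b).card = 3 := by
  rcases b with ⟨m, _ | ⟨d, i⟩⟩
  · rw [boseBlock, Finset.card_eq_three]
    refine ⟨_, _, _, ?_, ?_, ?_, rfl⟩ <;> simp [Prod.ext_iff] <;> decide
  · rw [boseBlock, Finset.card_eq_three]
    have h2 := half_cast_add_ne_zero d d
    refine ⟨_, _, _, ?_, ?_, ?_, rfl⟩
    · intro h
      refine h2 ?_
      linear_combination -(Prod.ext_iff.mp h).1
    · simp [Prod.ext_iff]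
    · simp [Prod.ext_iff]

theorem boseBlock_linear {v : ℕ} (a b : ZMod (2 * v + 1) × Option (Fin v × ZMod 3))
    (h : 1 < (boseBlock v a ∩ boseBlock v b).card) : a = b := by
  obtain ⟨⟨x, k⟩, hp, ⟨y, l⟩, hq, hne⟩ := Finset.one_lt_card.mp h
  rw [Finset.mem_inter] at hp hq
  obtain ⟨hpa, hpb⟩ := hp
  obtain ⟨hqa, hqb⟩ := hq
  have key : ∀ i j : ZMod 3, i = j + 1 → j ≠ i + 1 := by decide
  rcases a with ⟨m, _ | ⟨d, i⟩⟩ <;> rcases b with ⟨m', _ | ⟨d', i'⟩⟩ <;>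
    simp only [boseBlock, Finset.mem_insert, Finset.mem_singleton, Prod.mk.injEq] at hpa hpb hqa hqb
  · grind
  · have h1 := half_cast_ne_zero d'
    have h2 := half_cast_add_ne_zero d' d'
    generalize ((d' + 1 : ℕ) : ZMod (2 * v + 1)) = e at *
    exfalso
    grind
  · have h1 := half_cast_ne_zero d
    have h2 := half_cast_add_ne_zero d d
    generalize ((d + 1 : ℕ) : ZMod (2 * v + 1)) = e at *
    exfalso
    grind
  · have h1 := half_cast_ne_zero d
    have h1' := half_cast_ne_zero d'
    have h2 := half_cast_add_ne_zero d d'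
    have h3 := @half_cast_injective v d d'
    have h4 := @ZMod.eq_zero_of_add_self_eq_zero v (m - m')
    suffices m = m' ∧ ((d + 1 : ℕ) : ZMod (2 * v + 1)) = ((d' + 1 : ℕ) : ZMod (2 * v + 1)) ∧
        i = i' by
      rw [this.1, h3 this.2.1, this.2.2]
    clear h3
    have h5 := key i i'
    generalize ((d + 1 : ℕ) : ZMod (2 * v + 1)) = e at *
    generalize ((d' + 1 : ℕ) : ZMod (2 * v + 1)) = e' at *
    have h6 : i + 1 ≠ i := by simp
    have h7 : i' + 1 ≠ i' := by simp
    grind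

/-- Bose construction: for every `v ≥ 1` and every `3 ≤ n ≤ (2v+1)(3v+1)`
there is a `3`-out-of-`n` threshold padlock system with `6v + 3` padlocks,
hence `ℓ(3, n) = O(√n)`. -/
theorem bose_three_threshold (v n : ℕ) (hv : 1 ≤ v) (hn3 : 3 ≤ n)
    (hn : n ≤ (2 * v + 1) * (3 * v + 1)) :
    (∃ (F : Finset (Fin (6 * v + 3)) → Prop)
      (S : Fin n → Finset (Fin (6 * v + 3))),
      IsThresholdSystem 3 n (6 * v + 3) F S) ∧
    padlockNumber 3 n ≤ 6 * v + 3 := by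
  have : NeZero n := ⟨by omega⟩
  have hex := exists_isThresholdSystem_three (n := n) (t := 6 * v + 3)
    (by simp [ZMod.card]; linarith) (by simp [ZMod.card]; ring) (@card_boseBlock v)
    boseBlock_linear
  exact ⟨hex, Nat.sInf_le hex⟩
end

section
/- For every k and n with 2 ≤ k ≤ n, every k-out-of-n threshold padlock system with t padlocks satisfies t ≥ min(n, k(k + 1)/2). In particular, whenever k ≥ √(2n), no k-out-of-n threshold padlock system can use fewer than n padlocks. -/
/-- The family `S` restricted to `I` is `r`-cover-free: no member lies in the union of at most `r`
other members. -/
def IsCoverFree {ι α : Type*} [DecidableEq α] (r : ℕ) (I : Finset ι) (S : ι → Finset α) : Prop :=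
  ∀ i ∈ I, ∀ B ⊆ I, i ∉ B → B.card ≤ r → ¬ S i ⊆ B.biUnion S

namespace IsCoverFree

variable {ι α : Type*} [DecidableEq ι] [DecidableEq α] {r : ℕ} {I : Finset ι} {S : ι → Finset α}

/-- A small member of a cover-free family has a point belonging to no other member. -/
theorem exists_private_point (h : IsCoverFree r I S) {i : ι} (hi : i ∈ I) (hc : (S i).card ≤ r) :
    ∃ x ∈ S i, ∀ j ∈ I, x ∈ S j → j = i := by
  by_contra! hx
  have : Nonempty ι := ⟨i⟩
  choose! f hfI hfS hfi using hx
  refine h i hi ((S i).image f) ?_ ?_ (Finset.card_image_le.trans hc) ?_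
  · exact Finset.image_subset_iff.2 hfI
  · intro hmem
    obtain ⟨x, hxS, hx⟩ := Finset.mem_image.1 hmem
    exact hfi x hxS hx
  · exact fun x hx => Finset.mem_biUnion.2 ⟨f x, Finset.mem_image_of_mem f hx, hfS x hx⟩

/-- Deleting a member together with its points lowers the cover-free order by at most one. -/
theorem erase_sdiff (h : IsCoverFree (r + 1) I S) {i : ι} (hi : i ∈ I) :
    IsCoverFree r (I.erase i) (fun j => S j \ S i) := by
  intro j hj B hB hjB hBr hsub
  obtain ⟨hji, hjI⟩ := Finset.mem_erase.1 hj
  refine h j hjI (insert i B) ?_ ?_ ((Finset.card_insert_le _ _).trans (by lia)) fun x hx => ?_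
  · exact Finset.insert_subset hi (hB.trans (Finset.erase_subset _ _))
  · simp [hji, hjB]
  · by_cases hxi : x ∈ S i
    · exact Finset.mem_biUnion.2 ⟨i, Finset.mem_insert_self _ _, hxi⟩
    · obtain ⟨b, hb, hxb⟩ := Finset.mem_biUnion.1 (hsub (Finset.mem_sdiff.2 ⟨hx, hxi⟩))
      exact Finset.mem_biUnion.2 ⟨b, Finset.mem_insert_of_mem hb, (Finset.mem_sdiff.1 hxb).1⟩

/-- An `r`-cover-free family on fewer than `(r + 1) * (r + 2) / 2` points has at most as many
members as points. -/
theorem card_le_card (h : IsCoverFree r I S) {T : Finset α} (hST : ∀ i ∈ I, S i ⊆ T)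
    (hT : 2 * T.card < (r + 1) * (r + 2)) : I.card ≤ T.card := by
  induction r generalizing I S T with
  | zero =>
    have hT0 : T = ∅ := Finset.card_eq_zero.1 (by lia)
    have hI : I = ∅ := Finset.eq_empty_of_forall_notMem fun i hi =>
      h i hi ∅ (Finset.empty_subset _) (Finset.notMem_empty i) le_rfl
        ((hST i hi).trans (by simp [hT0]))
    simp [hI]
  | succ r ih =>
    by_cases hsmall : ∀ i ∈ I, (S i).card ≤ r + 1
    · refine Finset.card_le_card_of_forall_subsingleton
        (fun i x => x ∈ S i ∧ ∀ j ∈ I, x ∈ S j → j = i) (fun i hi => ?_)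
        fun x _ i hi j hj => hj.2.2 i hi.1 hi.2.1
      obtain ⟨x, hxS, hx⟩ := h.exists_private_point hi (hsmall i hi)
      exact ⟨x, hST i hi hxS, hxS, hx⟩
    · push Not at hsmall
      obtain ⟨i, hi, hc⟩ := hsmall
      have hle := Finset.card_le_card (hST i hi)
      have hcard := Finset.card_sdiff_of_subset (hST i hi)
      have hrec := ih (h.erase_sdiff hi) (T := T \ S i)
        (fun j hj => Finset.sdiff_subset_sdiff (hST j (Finset.mem_of_mem_erase hj)) subset_rfl)
        (by have : (T \ S i).card + (r + 2) ≤ T.card := by lia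
            nlinarith)
      rw [Finset.card_erase_of_mem hi] at hrec
      lia

end IsCoverFree

theorem IsThresholdSystem.isCoverFree {k n t : ℕ} {F : Finset (Fin t) → Prop}
    {S : Fin n → Finset (Fin t)} (h : IsThresholdSystem (k + 1) n t F S) (hn : k + 1 ≤ n) :
    IsCoverFree k Finset.univ S := by
  intro i _ B _ hiB hB hsub
  obtain ⟨C, hBC, hC, hCk⟩ := Finset.exists_subsuperset_card_eq
    (s := B) (t := Finset.univ.erase i) (n := k)
    (fun b hb => Finset.mem_erase.2 ⟨fun e => hiB (e ▸ hb), Finset.mem_univ b⟩) hB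
    (by rw [Finset.card_erase_of_mem (Finset.mem_univ i), Finset.card_fin]; lia)
  have hiC : i ∉ C := fun hi => Finset.notMem_erase i _ (hC hi)
  have hunion : (insert i C).biUnion S = C.biUnion S := by
    rw [Finset.biUnion_insert, Finset.union_eq_right]
    exact hsub.trans (Finset.biUnion_subset_biUnion_of_subset_left S hBC)
  have hopen := (h.2 (insert i C)).2 (by rw [Finset.card_insert_of_notMem hiC, hCk])
  rw [hunion, h.2 C] at hopen
  lia

/-- Any `k`-out-of-`n` threshold padlock system needs at least
`min(n, k(k+1)/2)` padlocks; in particular if `k ≥ √(2n)` then at least `n`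
padlocks are needed. -/
theorem min_padlocks_lower_bound (k n t : ℕ) (hk : 2 ≤ k) (hn : k ≤ n)
    (F : Finset (Fin t) → Prop) (S : Fin n → Finset (Fin t))
    (h : IsThresholdSystem k n t F S) :
    min n (k * (k + 1) / 2) ≤ t ∧
    (Real.sqrt (2 * n) ≤ k → n ≤ t) := by
  obtain ⟨r, rfl⟩ : ∃ r, k = r + 1 := ⟨k - 1, by lia⟩
  have hmin : min n ((r + 1) * (r + 1 + 1) / 2) ≤ t := by
    by_contra! hlt
    obtain ⟨hnt, hkt⟩ := lt_min_iff.1 hlt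
    have hcard := (h.isCoverFree hn).card_le_card (T := Finset.univ)
      (fun i _ => Finset.subset_univ (S i))
      (by rw [Finset.card_fin, show r + 2 = r + 1 + 1 from rfl]; lia)
    rw [Finset.card_fin, Finset.card_fin] at hcard
    lia
  refine ⟨hmin, fun hsqrt => ?_⟩
  have hsq : 2 * n ≤ (r + 1) ^ 2 := by
    exact_mod_cast (Real.sqrt_le_left (Nat.cast_nonneg _)).1 hsqrt
  have hle : n ≤ (r + 1) * (r + 1 + 1) / 2 := by
    rw [Nat.le_div_iff_mul_le two_pos]
    nlinarith
  rwa [min_eq_left hle] at hmin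
end

section
/- Let n ≥ 2 and let w ∈ FreeGroup (Fin n) be the element w = x₀ x₁ ⋯ x_{n−1} x₀⁻¹ x₁⁻¹ ⋯ x_{n−1}⁻¹ (the product of all generators in index order followed by the product of all their inverses in the same order). Then for every finite set S ⊆ Fin n, π_S w = 1 if and only if S.card ≥ n − 1. In other words, this knotted wiring realizes an (n−1)-out-of-n threshold system with 2n wrappings. -/
/-- Opening the padlocks in `S`: the homomorphism of the free group on the
padlock rings killing the generators indexed by `S`. -/
def openPadlocks {n : ℕ} (S : Finset (Fin n)) :
    FreeGroup (Fin n) →* FreeGroup (Fin n) :=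
  FreeGroup.lift fun i => if i ∈ S then (1 : FreeGroup (Fin n)) else .of i

/-- A product over `Fin n` with at most one nontrivial factor equals that factor. -/
theorem List.prod_ofFn_eq_single {M : Type*} [Monoid M] {n : ℕ} (f : Fin n → M) (i : Fin n)
    (h : ∀ k, k ≠ i → f k = 1) : (List.ofFn f).prod = f i := by
  induction n with
  | zero => exact i.elim0
  | succ n ih =>
    rw [List.ofFn_succ, List.prod_cons]
    induction i using Fin.cases with
    | zero =>
      have : (fun k : Fin n => f k.succ) = fun _ => 1 :=
        funext fun k => h _ (Fin.succ_ne_zero k)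
      simp [this]
    | succ i =>
      rw [h 0 (Fin.succ_ne_zero i).symm, one_mul]
      exact ih (fun k => f k.succ) i fun k hk => h _ (by simpa using hk)

/-- A product over `Fin n` with at most two nontrivial factors equals their ordered product. -/
theorem List.prod_ofFn_eq_mul {M : Type*} [Monoid M] {n : ℕ} (f : Fin n → M) {i j : Fin n}
    (hij : i < j) (h : ∀ k, k ≠ i → k ≠ j → f k = 1) : (List.ofFn f).prod = f i * f j := by
  induction n with
  | zero => exact i.elim0
  | succ n ih =>
    rw [List.ofFn_succ, List.prod_cons]
    induction j using Fin.cases with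
    | zero => simp at hij
    | succ j =>
      induction i using Fin.cases with
      | zero =>
        rw [List.prod_ofFn_eq_single (fun k : Fin n => f k.succ) j
          fun k hk => h _ (Fin.succ_ne_zero k) (by simpa using hk)]
      | succ i =>
        rw [h 0 (Fin.succ_ne_zero i).symm (Fin.succ_ne_zero j).symm, one_mul]
        exact ih (fun k => f k.succ) (by simpa using hij)
          fun k hi hj => h _ (by simpa using hi) (by simpa using hj)

/-- Any homomorphism sends the wiring to the wiring of the images of the rings. -/
theorem map_wiring {G : Type*} [Group G] {n : ℕ} (φ : FreeGroup (Fin n) →* G) :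
    φ ((List.ofFn fun i : Fin n => FreeGroup.of i).prod *
        (List.ofFn fun i : Fin n => (FreeGroup.of i)⁻¹).prod) =
      (List.ofFn fun i => φ (.of i)).prod * (List.ofFn fun i => (φ (.of i))⁻¹).prod := by
  simp [map_list_prod, List.map_ofFn, Function.comp_def]

/-- The wiring `x₀ x₁ ⋯ x_{n-1} x₀⁻¹ x₁⁻¹ ⋯ x_{n-1}⁻¹` realizes an
`(n-1)`-out-of-`n` knotted threshold padlock system with `2n` wrappings. -/
theorem knotted_n_minus_one_out_of_n (n : ℕ) (hn : 2 ≤ n) :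
    ∀ S : Finset (Fin n),
      openPadlocks S
        ((List.ofFn fun i : Fin n => FreeGroup.of i).prod *
          (List.ofFn fun i : Fin n => (FreeGroup.of i)⁻¹).prod) = 1 ↔
      n - 1 ≤ S.card := by
  intro S
  constructor
  · intro hw
    by_contra! hS
    have hc : 1 < Sᶜ.card := by
      rw [Finset.card_compl, Fintype.card_fin]
      omega
    obtain ⟨i, j, hi, hj, hij⟩ : ∃ i j, i ∈ Sᶜ ∧ j ∈ Sᶜ ∧ i < j := by
      obtain ⟨i, hi, j, hj, hne⟩ := Finset.one_lt_card.mp hc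
      rcases lt_or_gt_of_ne hne with h | h
      · exact ⟨i, j, hi, hj, h⟩
      · exact ⟨j, i, hj, hi, h⟩
    rw [Finset.mem_compl] at hi hj
    let g : Fin n → Equiv.Perm (Fin 3) := fun k =>
      if k = i then Equiv.swap 0 1 else if k = j then Equiv.swap 1 2 else 1
    let φ := (FreeGroup.lift g).comp (openPadlocks S)
    have hφ : ∀ k, φ (.of k) = g k := by
      intro k
      by_cases hk : k ∈ S
      · have hki : k ≠ i := fun h => hi (h ▸ hk)
        have hkj : k ≠ j := fun h => hj (h ▸ hk)
        simp [φ, openPadlocks, hk, g, hki, hkj]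
      · simp [φ, openPadlocks, hk]
    have hone : ∀ k, k ≠ i → k ≠ j → g k = 1 := fun k hki hkj => by simp [g, hki, hkj]
    have h := (map_wiring φ).symm.trans
      ((congrArg (FreeGroup.lift g) hw).trans (map_one _))
    simp only [hφ] at h
    rw [List.prod_ofFn_eq_mul g hij hone,
      List.prod_ofFn_eq_mul (fun k => (g k)⁻¹) hij
        fun k hki hkj => by simp [hone k hki hkj]] at h
    simp only [g, if_true, if_neg hij.ne'] at h
    revert h
    decide
  · intro hS
    have hc : Sᶜ.card ≤ 1 := by
      rw [Finset.card_compl, Fintype.card_fin]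
      omega
    have : Nonempty (Fin n) := ⟨⟨0, by omega⟩⟩
    obtain ⟨i, hi⟩ := Finset.card_le_one_iff_subset_singleton.mp hc
    have hone : ∀ k, k ≠ i → openPadlocks S (.of k) = 1 := by
      intro k hk
      have hkS : k ∈ S := by
        by_contra hkS
        exact hk (Finset.mem_singleton.mp (hi (Finset.mem_compl.mpr hkS)))
      simp [openPadlocks, hkS]
    rw [map_wiring, List.prod_ofFn_eq_single _ i hone,
      List.prod_ofFn_eq_single _ i fun k hk => by rw [hone k hk, inv_one], mul_inv_cancel]
end

section
/- Let k ≥ 1 and n ≥ k + 1, and suppose w ∈ FreeGroup (Fin n) satisfies: for every finite set S ⊆ Fin n, π_S w = 1 if and only if S.card ≥ k (i.e. w realizes a knotted k-out-of-n threshold padlock system). Then the reduced word of w (FreeGroup.toWord w) has even length, each generator occurs in it, and its length is at least 2n. -/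
/-- If the exponent sum of `i` in the word `L` vanishes, then the letters `i` and `i⁻¹` occur
equally often in `L`. -/
theorem FreeGroup.count_true_eq_count_false {α : Type*} [DecidableEq α] (i : α)
    (L : List (α × Bool))
    (h : FreeGroup.lift (fun j => if j = i then Multiplicative.ofAdd (1 : ℤ) else 1)
      (FreeGroup.mk L) = 1) :
    L.count (i, true) = L.count (i, false) := by
  have key : Multiplicative.toAdd
      (FreeGroup.lift (fun j => if j = i then Multiplicative.ofAdd (1 : ℤ) else 1)
        (FreeGroup.mk L)) = (L.count (i, true) : ℤ) - L.count (i, false) := by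
    clear h
    rw [FreeGroup.lift_mk]
    induction L with
    | nil => simp
    | cons p L ih =>
      obtain ⟨j, b⟩ := p
      rw [List.map_cons, List.prod_cons, toAdd_mul, ih]
      by_cases hj : j = i <;> cases b <;> simp [hj] <;> ring
  rw [h, toAdd_one] at key
  omega

theorem List.length_eq_sum_count_prod_bool {α : Type*} [Fintype α] [DecidableEq α]
    (L : List (α × Bool)) :
    L.length = ∑ i : α, (L.count (i, true) + L.count (i, false)) := by
  have h := Multiset.sum_count_eq_card (s := Finset.univ) (m := (L : Multiset (α × Bool)))
    fun _ _ => Finset.mem_univ _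
  simp only [Multiset.coe_count, Multiset.coe_card, Fintype.sum_prod_type,
    Fintype.sum_bool] at h
  convert h.symm

/-- Opening one more padlock has no effect if the wire is not wrapped around it. -/
theorem openPadlocks_insert_of_notMem_toWord {n : ℕ} (S : Finset (Fin n)) (i : Fin n)
    (w : FreeGroup (Fin n)) (h : ∀ p ∈ w.toWord, p.1 ≠ i) :
    openPadlocks (insert i S) w = openPadlocks S w := by
  rw [← FreeGroup.mk_toWord (x := w), openPadlocks, openPadlocks, FreeGroup.lift_mk,
    FreeGroup.lift_mk]
  congr 1
  refine List.map_congr_left fun p hp => ?_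
  simp [h p hp]

/-- If opening all padlocks but `i` frees the door, then the exponent sum of `i` vanishes. -/
theorem count_true_eq_count_false_of_openPadlocks_erase {n : ℕ} (i : Fin n)
    (w : FreeGroup (Fin n)) (h : openPadlocks (Finset.univ.erase i) w = 1) :
    w.toWord.count (i, true) = w.toWord.count (i, false) := by
  apply FreeGroup.count_true_eq_count_false
  rw [FreeGroup.mk_toWord]
  set φ := FreeGroup.lift fun j : Fin n => if j = i then Multiplicative.ofAdd (1 : ℤ) else 1
    with hφ
  have hcomp : φ.comp (openPadlocks (Finset.univ.erase i)) = φ := by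
    ext j
    by_cases hj : j = i <;> simp [hφ, openPadlocks, hj]
  rw [← hcomp, MonoidHom.comp_apply, h, map_one]

/-- Lower bound for knotted threshold systems: any word realizing a
`k`-out-of-`n` knotted threshold padlock system (`1 ≤ k`, `n ≥ k + 1`) has a
reduced word of even length, uses every generator, and has at least `2n`
wrappings. -/
theorem knotted_lower_bound (k n : ℕ) (hk : 1 ≤ k) (hn : k + 1 ≤ n)
    (w : FreeGroup (Fin n))
    (hw : ∀ S : Finset (Fin n), openPadlocks S w = 1 ↔ k ≤ S.card) :
    Even (FreeGroup.toWord w).length ∧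
    (∀ i : Fin n, ∃ p ∈ FreeGroup.toWord w, p.1 = i) ∧
    2 * n ≤ (FreeGroup.toWord w).length := by
  have hocc : ∀ i : Fin n, ∃ p ∈ w.toWord, p.1 = i := by
    intro i
    by_contra! hi
    obtain ⟨S, hS, hcard⟩ := Finset.exists_subset_card_eq
      (s := Finset.univ.erase i) (n := k - 1)
      (by rw [Finset.card_erase_of_mem (Finset.mem_univ i), Finset.card_fin]; omega)
    have hiS : i ∉ S := fun h => Finset.notMem_erase i _ (hS h)
    have hopen := (hw (insert i S)).2 (by rw [Finset.card_insert_of_notMem hiS]; omega)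
    rw [openPadlocks_insert_of_notMem_toWord S i w hi, hw] at hopen
    omega
  have hcount : ∀ i : Fin n, w.toWord.count (i, true) = w.toWord.count (i, false) := fun i =>
    count_true_eq_count_false_of_openPadlocks_erase i w <| (hw _).2 <| by
      rw [Finset.card_erase_of_mem (Finset.mem_univ i), Finset.card_fin]; omega
  have hlen : w.toWord.length = 2 * ∑ i : Fin n, w.toWord.count (i, false) := by
    simp [List.length_eq_sum_count_prod_bool, hcount, Finset.mul_sum, two_mul]
  have hpos : ∀ i : Fin n, 1 ≤ w.toWord.count (i, false) := by
    intro i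
    obtain ⟨⟨j, b⟩, hp, rfl⟩ := hocc i
    cases b
    · exact List.count_pos_iff.2 hp
    · exact hcount j ▸ List.count_pos_iff.2 hp
  refine ⟨hlen ▸ even_two_mul _, hocc, hlen ▸ Nat.mul_le_mul_left 2 ?_⟩
  simpa using Finset.card_nsmul_le_sum Finset.univ _ 1 fun i _ => hpos i
end

section
/- For all natural numbers k, n with 1 ≤ k ≤ n, there exists an element w ∈ FreeGroup (Option (Fin n)) (where the extra generator corresponding to none represents a fixed ring that is never opened) such that for every finite set S ⊆ Fin n, the group homomorphism FreeGroup (Option (Fin n)) →* FreeGroup (Option (Fin n)) sending the generator x_{some i} to 1 for i ∈ S and fixing all other generators maps w to 1 if and only if S.card ≥ k. That is, knotted padlock k-out-of-n threshold systems exist for every threshold k. -/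
/-- Opening the padlocks in `S`: the homomorphism of the free group on the
padlock rings (plus one extra unopenable ring `none`) killing the generators
`some i` with `i ∈ S` and fixing all other generators. -/
def openPadlocks' {n : ℕ} (S : Finset (Fin n)) :
    FreeGroup (Option (Fin n)) →* FreeGroup (Option (Fin n)) :=
  FreeGroup.lift fun o => match o with
    | some i => if i ∈ S then (1 : FreeGroup (Option (Fin n))) else .of (some i)
    | none => .of none

open scoped commutatorElement

/-- The iterated commutator of the padlock rings in `l` around the fixed ring. -/
def iteratedCommutator {n : ℕ} : List (Fin n) → FreeGroup (Option (Fin n))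
  | [] => .of none
  | t :: l => ⁅FreeGroup.of (some t), iteratedCommutator l⁆

theorem iteratedCommutator_ne_one {n : ℕ} (l : List (Fin n)) : iteratedCommutator l ≠ 1 := by
  let f : FreeGroup (Option (Fin n)) →* Equiv.Perm (Fin 3) :=
    FreeGroup.lift fun o => o.elim (finRotate 3) fun _ => Equiv.swap 0 1
  have hf : f (iteratedCommutator l) = finRotate 3 := by
    induction l with
    | nil => simp [iteratedCommutator, f]
    | cons t l ih =>
      rw [iteratedCommutator, map_commutatorElement, ih]
      simp only [f, FreeGroup.lift_apply_of, Option.elim]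
      decide
  intro h
  rw [h, map_one] at hf
  exact absurd hf (by decide)

theorem openPadlocks'_of_some {n : ℕ} (S : Finset (Fin n)) (i : Fin n) :
    openPadlocks' S (FreeGroup.of (some i)) = if i ∈ S then 1 else .of (some i) := by
  simp [openPadlocks']

theorem openPadlocks'_of_none {n : ℕ} (S : Finset (Fin n)) :
    openPadlocks' S (FreeGroup.of none) = .of none := by
  simp [openPadlocks']

theorem openPadlocks'_openPadlocks'_of_subset {n : ℕ} {S U : Finset (Fin n)} (h : S ⊆ U)
    (w : FreeGroup (Option (Fin n))) :
    openPadlocks' U (openPadlocks' S w) = openPadlocks' U w := by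
  suffices (openPadlocks' U).comp (openPadlocks' S) = openPadlocks' U from DFunLike.congr_fun this w
  ext o
  cases o with
  | none => simp [openPadlocks'_of_none]
  | some i =>
    by_cases hi : i ∈ S
    · simp [openPadlocks'_of_some, hi, h hi]
    · simp [openPadlocks'_of_some, hi]

theorem openPadlocks'_iteratedCommutator_eq_one {n : ℕ} {S : Finset (Fin n)} {l : List (Fin n)}
    (h : ∃ t ∈ l, t ∈ S) : openPadlocks' S (iteratedCommutator l) = 1 := by
  induction l with
  | nil => simp at h
  | cons t l ih =>
    rw [iteratedCommutator, map_commutatorElement, openPadlocks'_of_some]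
    by_cases ht : t ∈ S
    · simp [ht]
    · rw [ih (by simpa [ht] using h), commutatorElement_one_right]

theorem openPadlocks'_iteratedCommutator_eq_self {n : ℕ} {S : Finset (Fin n)} {l : List (Fin n)}
    (h : ∀ t ∈ l, t ∉ S) : openPadlocks' S (iteratedCommutator l) = iteratedCommutator l := by
  induction l with
  | nil => exact openPadlocks'_of_none S
  | cons t l ih =>
    rw [List.forall_mem_cons] at h
    rw [iteratedCommutator, map_commutatorElement, openPadlocks'_of_some, if_neg h.1, ih h.2]

/-- Knotted `k`-out-of-`n` threshold padlock systems exist for every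
threshold `1 ≤ k ≤ n`, using one extra fixed ring. -/
theorem knotted_threshold_exists (k n : ℕ) (hk : 1 ≤ k) (hn : k ≤ n) :
    ∃ w : FreeGroup (Option (Fin n)),
      ∀ S : Finset (Fin n), openPadlocks' S w = 1 ↔ k ≤ S.card := by
  let L := (Finset.univ.powersetCard (n - k + 1) : Finset (Finset (Fin n))).toList
  have hL (S : Finset (Fin n)) :
      openPadlocks' S (L.map fun T => iteratedCommutator T.toList).prod =
        (L.map fun T => openPadlocks' S (iteratedCommutator T.toList)).prod := by
    rw [map_list_prod, List.map_map]
    rfl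
  refine ⟨(L.map fun T => iteratedCommutator T.toList).prod, fun S => ⟨fun h => ?_, fun h => ?_⟩⟩
  · by_contra! hS
    obtain ⟨U, hSU, -, hU⟩ := Finset.exists_subsuperset_card_eq (n := k - 1) (Finset.subset_univ S)
      (by lia) (by simp; lia)
    have hUc : Uᶜ.card = n - k + 1 := by
      rw [Finset.card_compl, Fintype.card_fin]
      lia
    have h1 := openPadlocks'_openPadlocks'_of_subset hSU
      (L.map fun T => iteratedCommutator T.toList).prod
    rw [h, map_one, hL, List.prod_map_eq_pow_single Uᶜ, List.count_eq_one_of_mem, pow_one,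
      openPadlocks'_iteratedCommutator_eq_self (by simp)] at h1
    · exact iteratedCommutator_ne_one _ h1.symm
    · exact Finset.nodup_toList _
    · simp [L, hUc]
    · intro T hT hTL
      have hTc : T.card = n - k + 1 := by simpa [L] using hTL
      refine openPadlocks'_iteratedCommutator_eq_one ?_
      by_contra! hd
      refine hT (Finset.eq_of_subset_of_card_le (fun t ht => ?_) (by lia))
      simpa using hd t (by simpa using ht)
  · rw [hL]
    refine List.prod_eq_one fun x hx => ?_
    obtain ⟨T, hT, rfl⟩ := List.mem_map.1 hx
    have hTc : T.card = n - k + 1 := by simpa [L] using hT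
    refine openPadlocks'_iteratedCommutator_eq_one ?_
    by_contra! hd
    have hdisj : Disjoint T S := Finset.disjoint_left.2 fun t ht => hd t (by simpa using ht)
    have hcard := Finset.card_le_univ (T ∪ S)
    rw [Finset.card_union_of_disjoint hdisj, Fintype.card_fin] at hcard
    lia
end

section
/- Let i ≥ 1 be a natural number, c a real number, and T, e : ℕ → ℝ functions such that T n = T ⌈n/2⌉ + c · (Real.logb 2 (n / 2))^i + e n for all n ≥ 2, where e n = o((Real.log n)^i) as n → ∞ (Asymptotics.IsLittleO along Filter.atTop). Then T n = (c / (i + 1)) · (Real.logb 2 n)^(i+1) + o((Real.log n)^(i+1)) as n → ∞; i.e. the function n ↦ T n − (c/(i+1)) · (Real.logb 2 n)^(i+1) is o((Real.log n)^(i+1)) along atTop. -/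
open Filter Asymptotics

/-- Stolz–Cesàro principle along a recursion `n ↦ m n < n`: if the increment of `D` from `m n` to
`n` is negligible compared with that of a function `A` tending to infinity, then `D = o(A)`. -/
theorem isLittleO_of_sub_isLittleO_sub {D A : ℕ → ℝ} {m : ℕ → ℕ}
    (hm : ∀ᶠ n in atTop, m n < n) (hA0 : ∀ n, 0 ≤ A n) (hA : Tendsto A atTop atTop)
    (hmono : ∀ᶠ n in atTop, A (m n) ≤ A n)
    (h : (fun n => D n - D (m n)) =o[atTop] fun n => A n - A (m n)) :
    D =o[atTop] A := by
  rw [isLittleO_iff]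
  intro ε hε
  have hε2 : 0 < ε / 2 := by positivity
  obtain ⟨N, hN⟩ := eventually_atTop.1 ((h.bound hε2).and (hm.and hmono))
  set C := ∑ k ∈ Finset.range N, |D k| with hC
  have key : ∀ n, |D n| ≤ C + ε / 2 * A n := by
    intro n
    induction n using Nat.strong_induction_on with
    | _ n ih =>
      rcases lt_or_ge n N with hn | hn
      · have h1 : |D n| ≤ C :=
          Finset.single_le_sum (f := fun k => |D k|) (fun k _ => abs_nonneg _)
            (Finset.mem_range.2 hn)
        have h2 := mul_nonneg hε2.le (hA0 n)
        linarith
      · obtain ⟨h1, h2, h3⟩ := hN n hn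
        have h4 := ih (m n) h2
        rw [Real.norm_eq_abs, Real.norm_eq_abs, abs_of_nonneg (sub_nonneg.2 h3)] at h1
        have h5 := abs_sub_abs_le_abs_sub (D n) (D (m n))
        linarith
  filter_upwards [hA.eventually_ge_atTop (C / (ε / 2))] with n hn
  rw [Real.norm_eq_abs, Real.norm_eq_abs, abs_of_nonneg (hA0 n)]
  rw [div_le_iff₀ hε2] at hn
  linarith [key n]

theorem tendsto_logb_two_natCast : Tendsto (fun n : ℕ => Real.logb 2 (n : ℝ)) atTop atTop :=
  (Real.tendsto_logb_atTop one_lt_two).comp tendsto_natCast_atTop_atTop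

theorem tendsto_half_ceil_div :
    Tendsto (fun n : ℕ => (((n + 1) / 2 : ℕ) : ℝ) / n) atTop (nhds (1 / 2)) := by
  have hlim : Tendsto (fun n : ℕ => (1 / 2 : ℝ) + 1 / n) atTop (nhds (1 / 2)) := by
    simpa using tendsto_one_div_atTop_nhds_zero_nat.const_add (1 / 2 : ℝ)
  refine tendsto_of_tendsto_of_tendsto_of_le_of_le' tendsto_const_nhds hlim ?_ ?_
  · filter_upwards [eventually_gt_atTop 0] with n hn
    have hn' : (0 : ℝ) < n := by exact_mod_cast hn
    have h : (n : ℝ) ≤ 2 * ((n + 1) / 2 : ℕ) := by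
      exact_mod_cast (by omega : n ≤ 2 * ((n + 1) / 2))
    rw [le_div_iff₀ hn']
    linarith
  · filter_upwards [eventually_gt_atTop 0] with n hn
    have hn' : (0 : ℝ) < n := by exact_mod_cast hn
    have h : 2 * (((n + 1) / 2 : ℕ) : ℝ) ≤ n + 1 := by
      exact_mod_cast (by omega : 2 * ((n + 1) / 2) ≤ n + 1)
    rw [div_le_iff₀ hn', add_mul, one_div_mul_cancel hn'.ne']
    linarith

theorem tendsto_logb_sub_logb_half_ceil :
    Tendsto (fun n : ℕ => Real.logb 2 (n : ℝ) - Real.logb 2 (((n + 1) / 2 : ℕ) : ℝ))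
      atTop (nhds 1) := by
  have h := ((Real.continuousAt_log (by norm_num : (1 / 2 : ℝ) ≠ 0)).tendsto.comp
    tendsto_half_ceil_div).div_const (-Real.log 2)
  have h2 : Real.log 2 ≠ 0 := (Real.log_pos one_lt_two).ne'
  have h1 : Real.log (1 / 2) / -Real.log 2 = 1 := by
    rw [one_div, Real.log_inv, div_self (neg_ne_zero.2 h2)]
  rw [h1] at h
  refine h.congr' ?_
  filter_upwards [eventually_gt_atTop 0] with n hn
  have hn' : (n : ℝ) ≠ 0 := by exact_mod_cast hn.ne'
  have hm : (((n + 1) / 2 : ℕ) : ℝ) ≠ 0 := by exact_mod_cast (by omega : (n + 1) / 2 ≠ 0)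
  simp only [Function.comp_apply, Real.log_div hm hn', Real.logb]
  field_simp
  ring

/-- If `x → ∞` and `x - y → 1`, then `(x ^ (i + 1) - y ^ (i + 1)) / x ^ i → i + 1`. -/
theorem tendsto_pow_succ_sub_pow_succ_div {α : Type*} {l : Filter α} {x y : α → ℝ}
    (hx : Tendsto x l atTop) (hxy : Tendsto (fun a => x a - y a) l (nhds 1)) (i : ℕ) :
    Tendsto (fun a => (x a ^ (i + 1) - y a ^ (i + 1)) / x a ^ i) l (nhds (i + 1)) := by
  have hr : Tendsto (fun a => 1 - (x a - y a) / x a) l (nhds 1) := by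
    simpa using (hxy.div_atTop hx).const_sub 1
  have hs := (tendsto_finsetSum (Finset.range (i + 1)) fun k _ => hr.pow k).mul hxy
  simp only [one_pow, Finset.sum_const, Finset.card_range, nsmul_eq_mul, mul_one,
    Nat.cast_add, Nat.cast_one] at hs
  refine hs.congr' ?_
  filter_upwards [hx.eventually_gt_atTop 0] with a ha
  have hq : 1 - (x a - y a) / x a = y a / x a := by field_simp; ring
  have hp : x a - y a = -(y a / x a - 1) * x a := by field_simp; ring
  rw [hq, hp, ← mul_assoc, mul_neg, geom_sum_mul, div_pow]
  field_simp
  ring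

/-- Master-theorem variant: if
`T n = T ⌈n/2⌉ + c (log₂ (n/2))^i + e n` with `e n = o((log n)^i)`, then
`T n = (c/(i+1)) (log₂ n)^(i+1) + o((log n)^(i+1))`. -/
theorem master_log_recurrence (i : ℕ) (hi : 1 ≤ i) (c : ℝ) (T e : ℕ → ℝ)
    (hrec : ∀ n : ℕ, 2 ≤ n →
      T n = T ((n + 1) / 2) + c * (Real.logb 2 ((n : ℝ) / 2)) ^ i + e n)
    (he : e =o[atTop] fun n : ℕ => (Real.log n) ^ i) :
    (fun n : ℕ => T n - (c / (i + 1)) * (Real.logb 2 n) ^ (i + 1))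
      =o[atTop] fun n : ℕ => (Real.log n) ^ (i + 1) := by
  have h2 : Real.log 2 ≠ 0 := (Real.log_pos one_lt_two).ne'
  have hi1 : (i + 1 : ℝ) ≠ 0 := by positivity
  have hlog : ∀ n : ℕ, Real.log n = Real.log 2 * Real.logb 2 n := fun n => by
    rw [Real.logb]; field_simp
  simp only [hlog, mul_pow] at he ⊢
  rw [isLittleO_const_mul_right_iff (pow_ne_zero _ h2)] at he ⊢
  have hpos : ∀ᶠ n : ℕ in atTop, 0 < Real.logb 2 (n : ℝ) :=
    tendsto_logb_two_natCast.eventually_gt_atTop 0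
  have hne : ∀ᶠ n : ℕ in atTop, Real.logb 2 (n : ℝ) ^ i ≠ 0 :=
    hpos.mono fun n hn => (pow_pos hn i).ne'
  have hdiff := tendsto_pow_succ_sub_pow_succ_div tendsto_logb_two_natCast
    tendsto_logb_sub_logb_half_ceil i
  have hge : ∀ᶠ n : ℕ in atTop, Real.logb 2 (n : ℝ) ^ i / 2 ≤
      Real.logb 2 (n : ℝ) ^ (i + 1) - Real.logb 2 (((n + 1) / 2 : ℕ) : ℝ) ^ (i + 1) := by
    filter_upwards [hpos, hdiff.eventually_const_le
      (show (1 / 2 : ℝ) < i + 1 by linarith [(Nat.cast_nonneg i : (0 : ℝ) ≤ i)])] with n hn h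
    rw [le_div_iff₀ (pow_pos hn i)] at h
    linarith
  have hA0 : ∀ n : ℕ, 0 ≤ Real.logb 2 (n : ℝ) ^ (i + 1) := fun n => by
    rw [Real.logb]
    exact pow_nonneg (div_nonneg (Real.log_natCast_nonneg n) (Real.log_pos one_lt_two).le) _
  refine isLittleO_of_sub_isLittleO_sub (m := fun n => (n + 1) / 2) ?_ hA0 ?_ ?_ ?_
  · filter_upwards [eventually_ge_atTop 2] with n hn
    omega
  · exact (tendsto_pow_atTop i.succ_ne_zero).comp tendsto_logb_two_natCast
  · filter_upwards [hpos, hge] with n hn h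
    linarith [pow_pos hn i]
  · have hO : (fun n : ℕ => Real.logb 2 (n : ℝ) ^ i) =O[atTop] fun n : ℕ =>
        Real.logb 2 (n : ℝ) ^ (i + 1) - Real.logb 2 (((n + 1) / 2 : ℕ) : ℝ) ^ (i + 1) := by
      refine IsBigO.of_bound 2 ?_
      filter_upwards [hpos, hge] with n hn h
      have hp := pow_pos hn i
      rw [Real.norm_eq_abs, Real.norm_eq_abs, abs_of_pos hp, abs_of_nonneg (by linarith)]
      linarith
    refine IsLittleO.trans_isBigO ?_ hO
    rw [isLittleO_iff_tendsto' (hne.mono fun n h h0 => absurd h0 h)] at he ⊢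
    have hshift : Tendsto (fun n : ℕ => (1 - 1 / Real.logb 2 (n : ℝ)) ^ i) atTop (nhds 1) := by
      simpa using ((tendsto_const_nhds (x := (1 : ℝ)).div_atTop
        tendsto_logb_two_natCast).const_sub 1).pow i
    have hlim := ((hshift.const_mul c).add he).sub (hdiff.const_mul (c / (i + 1)))
    rw [div_mul_cancel₀ c hi1, mul_one, add_zero, sub_self] at hlim
    refine hlim.congr' ?_
    filter_upwards [hpos, eventually_ge_atTop 2] with n hn hn2
    have hn0 : (n : ℝ) ≠ 0 := by positivity
    have hhalf : Real.logb 2 ((n : ℝ) / 2) = Real.logb 2 n - 1 := by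
      rw [Real.logb_div hn0 two_ne_zero, Real.logb_self_eq_one one_lt_two]
    have hq : 1 - 1 / Real.logb 2 (n : ℝ) = (Real.logb 2 n - 1) / Real.logb 2 n := by
      field_simp
    rw [hrec n hn2, hhalf, hq, div_pow]
    ring
end

section
/- For every real ε > 0 there exists N such that for every natural number n ≥ N there exists a 3-out-of-n threshold padlock system with at most ⌊(2 + ε) · (Real.logb 2 n)^2⌋ padlocks. In particular ℓ(3, n) ≤ 2 (log₂ n)² + o((log n)²). -/
/-- A family in which no member is covered by two others yields a `3`-out-of-`n` threshold
padlock system: the door opens when the keys of some three participants are all available. -/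
theorem exists_isThresholdSystem_three_of_coverFree {ι : Type*} [Fintype ι] {n : ℕ}
    (T : Fin n → Set ι)
    (hT : ∀ a b c, c ≠ a → c ≠ b → ∃ x ∈ T c, x ∉ T a ∧ x ∉ T b) :
    ∃ (F : Finset (Fin (Fintype.card ι)) → Prop) (S : Fin n → Finset (Fin (Fintype.card ι))),
      IsThresholdSystem 3 n (Fintype.card ι) F S := by
  classical
  let e := Fintype.equivFin ι
  let S : Fin n → Finset (Fin (Fintype.card ι)) := fun c => {x | e.symm x ∈ T c}
  refine ⟨fun B => ∃ H : Finset (Fin n), 3 ≤ H.card ∧ H.biUnion S ⊆ B, S, ?_, fun G => ⟨?_, ?_⟩⟩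
  · rintro A B hAB ⟨H, hH, hHA⟩
    exact ⟨H, hH, hHA.trans hAB⟩
  · rintro ⟨H, hH, hHG⟩
    by_contra! hG
    obtain ⟨c, hcH, hcG⟩ := Finset.exists_mem_notMem_of_card_lt_card (hG.trans_le hH)
    obtain ⟨a, b, hca, hcb, hab⟩ : ∃ a b, c ≠ a ∧ c ≠ b ∧ ∀ d ∈ G, d = a ∨ d = b := by
      obtain ⟨G', hGG', hcG', hG'⟩ : ∃ G', G ⊆ G' ∧ c ∉ G' ∧ G'.card = 2 := by
        have hn : 3 ≤ n := by simpa using hH.trans (Finset.card_le_univ H)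
        obtain ⟨G', hGG', hG'c, hG'⟩ := Finset.exists_subsuperset_card_eq
          (s := G) (t := Finset.univ.erase c) (n := 2)
          (fun d hd => Finset.mem_erase.2 ⟨fun h => hcG (h ▸ hd), Finset.mem_univ d⟩)
          (by omega) (by simp; omega)
        exact ⟨G', hGG', fun h => by simpa using hG'c h, hG'⟩
      obtain ⟨a, b, -, rfl⟩ := Finset.card_eq_two.1 hG'
      refine ⟨a, b, ?_, ?_, fun d hd => by simpa using hGG' hd⟩ <;> rintro rfl <;> simp at hcG'
    obtain ⟨x, hxc, hxa, hxb⟩ := hT a b c hca hcb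
    have hx : e x ∈ G.biUnion S :=
      hHG (Finset.mem_biUnion.2 ⟨c, hcH, by simpa [S] using hxc⟩)
    obtain ⟨d, hd, hxd⟩ := Finset.mem_biUnion.1 hx
    have hxd : x ∈ T d := by simpa [S] using hxd
    rcases hab d hd with rfl | rfl
    exacts [hxa hxd, hxb hxd]
  · exact fun hG => ⟨G, hG, subset_rfl⟩

/-- Distinct numbers below `2 ^ m` differ in one of their `m` lowest bits. -/
theorem exists_testBit_ne_of_lt_two_pow_s18 {m a c : ℕ} (ha : a < 2 ^ m) (hc : c < 2 ^ m)
    (h : c ≠ a) : ∃ i < m, c.testBit i ≠ a.testBit i := by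
  contrapose! h
  refine Nat.eq_of_testBit_eq fun i => ?_
  by_cases hi : i < m
  · exact h i hi
  · have hpow : 2 ^ m ≤ 2 ^ i := Nat.pow_le_pow_right two_pos (not_lt.1 hi)
    rw [Nat.testBit_lt_two_pow (hc.trans_le hpow), Nat.testBit_lt_two_pow (ha.trans_le hpow)]

/-- Padlocks indexed by two of `m` bit positions and a prescribed value at each of them. -/
abbrev BitPairPattern (m : ℕ) : Type := (Σ j : Fin m, Fin j) × Bool × Bool

theorem card_bitPairPattern (m : ℕ) :
    Fintype.card (BitPairPattern m) = 2 * (m * (m - 1)) := by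
  have h := Finset.sum_range_id_mul_two m
  simp only [Fintype.card_prod, Fintype.card_sigma, Fintype.card_fin, Fintype.card_bool,
    Fin.sum_univ_eq_sum_range (fun j => j) m]
  omega

/-- The patterns that the binary expansion of `c` matches. -/
def bitPairPatterns (m c : ℕ) : Set (BitPairPattern m) :=
  {x | c.testBit x.1.2 = x.2.1 ∧ c.testBit x.1.1 = x.2.2}

theorem bitPairPatterns_coverFree {m a b c : ℕ} (hm : 2 ≤ m) (ha : a < 2 ^ m) (hb : b < 2 ^ m)
    (hc : c < 2 ^ m) (hca : c ≠ a) (hcb : c ≠ b) :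
    ∃ x ∈ bitPairPatterns m c, x ∉ bitPairPatterns m a ∧ x ∉ bitPairPatterns m b := by
  obtain ⟨i, hi, hia⟩ := exists_testBit_ne_of_lt_two_pow_s18 ha hc hca
  obtain ⟨j, hj, hjb⟩ := exists_testBit_ne_of_lt_two_pow_s18 hb hc hcb
  obtain ⟨p, q, hpq, hq, hip, hjp⟩ :
      ∃ p q, p < q ∧ q < m ∧ (i = p ∨ i = q) ∧ (j = p ∨ j = q) := by
    rcases lt_trichotomy i j with h | rfl | h
    · exact ⟨i, j, h, hj, by simp, by simp⟩
    · rcases Nat.eq_zero_or_pos i with rfl | h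
      · exact ⟨0, 1, by omega, by omega, by simp, by simp⟩
      · exact ⟨0, i, h, hi, by simp, by simp⟩
    · exact ⟨j, i, h, hi, by simp, by simp⟩
  refine ⟨⟨⟨⟨q, hq⟩, ⟨p, hpq⟩⟩, c.testBit p, c.testBit q⟩, ⟨rfl, rfl⟩, ?_, ?_⟩
  · rintro ⟨h₁, h₂⟩
    rcases hip with rfl | rfl
    exacts [hia h₁.symm, hia h₂.symm]
  · rintro ⟨h₁, h₂⟩
    rcases hjp with rfl | rfl
    exacts [hjb h₁.symm, hjb h₂.symm]

/-- Asymptotically, `3`-out-of-`n` threshold padlock systems exist with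
`(2 + ε)(log₂ n)²` padlocks for any `ε > 0`, i.e.
`ℓ(3, n) ≤ 2 (log₂ n)² + o((log n)²)`. -/
theorem three_threshold_log_squared (ε : ℝ) (hε : 0 < ε) :
    ∃ N : ℕ, ∀ n : ℕ, N ≤ n →
      ∃ t : ℕ, t ≤ ⌊(2 + ε) * (Real.logb 2 n) ^ 2⌋₊ ∧
        ∃ (F : Finset (Fin t) → Prop) (S : Fin n → Finset (Fin t)),
          IsThresholdSystem 3 n t F S := by
  have htendsto : Filter.Tendsto (fun n : ℕ => Real.logb 2 n) Filter.atTop Filter.atTop :=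
    (Real.tendsto_logb_atTop one_lt_two).comp tendsto_natCast_atTop_atTop
  obtain ⟨N, hN⟩ := Filter.eventually_atTop.1
    ((htendsto.eventually_ge_atTop (2 / ε)).and (Filter.eventually_ge_atTop 3))
  refine ⟨N, fun n hn => ?_⟩
  obtain ⟨hlog, hn3⟩ := hN n hn
  set m := Nat.clog 2 n
  have hnm : n ≤ 2 ^ m := Nat.le_pow_clog one_lt_two n
  have hm2 : 2 ≤ m := by
    by_contra! h
    have := Nat.pow_le_pow_right two_pos (Nat.le_of_lt_succ h)
    omega
  refine ⟨Fintype.card (BitPairPattern m), Nat.le_floor ?_,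
    exists_isThresholdSystem_three_of_coverFree (fun c => bitPairPatterns m c)
      fun a b c hca hcb => bitPairPatterns_coverFree hm2 (a.2.trans_le hnm) (b.2.trans_le hnm)
        (c.2.trans_le hnm) (Fin.val_ne_of_ne hca) (Fin.val_ne_of_ne hcb)⟩
  have hpred : 2 ^ (m - 1) < n := Nat.pow_pred_clog_lt_self one_lt_two (by omega)
  have hmlog : ((m - 1 : ℕ) : ℝ) ≤ Real.logb 2 n := by
    rw [Real.le_logb_iff_rpow_le one_lt_two (by positivity), Real.rpow_natCast]
    exact_mod_cast hpred.le
  have hεlog : 2 ≤ ε * Real.logb 2 n := by rwa [div_le_iff₀' hε] at hlog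
  have hlog0 : 0 ≤ Real.logb 2 n := (by positivity : (0 : ℝ) ≤ 2 / ε).trans hlog
  rw [card_bitPairPattern]
  push_cast [Nat.cast_sub (show 1 ≤ m by omega)] at hmlog ⊢
  have hm1 : (1 : ℝ) ≤ m := by exact_mod_cast (by omega : 1 ≤ m)
  calc 2 * ((m : ℝ) * (m - 1))
      ≤ 2 * ((Real.logb 2 n + 1) * Real.logb 2 n) := by
        gcongr
        · linarith
    _ ≤ (2 + ε) * Real.logb 2 n ^ 2 := by nlinarith
end

section
/- For every natural number k ≥ 2 and every real ε > 0 there exists N such that for every natural number n ≥ N there exists a k-out-of-n threshold padlock system with at most ⌊(2^(k−1) / (k−1)! + ε) · (Real.logb 2 n)^(k−1)⌋ padlocks. In particular, for each fixed k the minimal number of padlocks satisfies ℓ(k, n) = O((log n)^(k−1)). -/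
open Filter Topology in
/-- Shifting the variable by one does not change the leading coefficient of a power. -/
theorem eventually_mul_add_one_pow_le (c ε : ℝ) (hε : 0 < ε) (r : ℕ) :
    ∀ᶠ x : ℝ in atTop, c * (x + 1) ^ r ≤ (c + ε) * x ^ r := by
  have h : Tendsto (fun x : ℝ => c * (1 + x⁻¹) ^ r) atTop (𝓝 c) := by
    simpa using ((tendsto_inv_atTop_zero.const_add (1 : ℝ)).pow r).const_mul c
  filter_upwards [h.eventually_lt_const (lt_add_of_pos_right c hε), eventually_gt_atTop 0]
    with x hx hx0
  calc c * (x + 1) ^ r = c * (1 + x⁻¹) ^ r * x ^ r := by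
        rw [mul_assoc, ← mul_pow, add_mul, inv_mul_cancel₀ hx0.ne', one_mul]
    _ ≤ (c + ε) * x ^ r := by gcongr

/-- A function that disagrees with each member of a family of at most `r` functions can be
separated from all of them by its values on `r` coordinates. -/
theorem exists_card_eq_forall_exists_ne {ι β : Type*} [Fintype ι] {r : ℕ}
    (hr : r ≤ Fintype.card ι) (x : ι → β) (H : Finset (ι → β)) (hH : H.card ≤ r) (hx : x ∉ H) :
    ∃ D : Finset ι, D.card = r ∧ ∀ h ∈ H, ∃ c ∈ D, h c ≠ x c := by
  classical
  have hne : ∀ h : H, ∃ c, h.1 c ≠ x c := fun h =>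
    Function.ne_iff.mp fun e => hx (e ▸ h.2)
  choose c hc using hne
  obtain ⟨D, hsub, hcard⟩ := Finset.exists_superset_card_eq (s := H.attach.image c)
    (Finset.card_image_le.trans (by simpa using hH)) hr
  exact ⟨D, hcard, fun h hh =>
    ⟨c ⟨h, hh⟩, hsub (Finset.mem_image_of_mem c (Finset.mem_attach H ⟨h, hh⟩)), hc ⟨h, hh⟩⟩⟩

/-- If no participant's keys are covered by those of fewer than `k` others, then the participants
form a `k`-out-of-`n` threshold system. -/
theorem exists_isThresholdSystem_of_coverFree {k n t : ℕ} {S : Fin n → Finset (Fin t)}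
    (hS : ∀ i, ∀ H : Finset (Fin n), H.card < k → i ∉ H → ¬ S i ⊆ H.biUnion S) :
    ∃ F, IsThresholdSystem k n t F S := by
  refine ⟨fun A => ∃ G : Finset (Fin n), k ≤ G.card ∧ G.biUnion S ⊆ A,
    fun A B hAB ⟨G, hG, hGA⟩ => ⟨G, hG, hGA.trans hAB⟩,
    fun H => ⟨fun ⟨G, hG, hGH⟩ => ?_, fun hH => ⟨H, hH, subset_rfl⟩⟩⟩
  by_contra! hH
  obtain ⟨i, hiG, hiH⟩ := Finset.exists_mem_notMem_of_card_lt_card (hH.trans_le hG)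
  exact hS i H hH hiH ((Finset.subset_biUnion_of_mem S hiG).trans hGH)

/-- With one padlock for every partial assignment of `r` out of `j` bits, and participants
labelled by distinct `j`-bit words, one obtains an `(r + 1)`-threshold system. -/
theorem exists_isThresholdSystem_choose {r j n : ℕ} (hr : r ≤ j) (hn : n ≤ 2 ^ j) :
    ∃ F S, IsThresholdSystem (r + 1) n (j.choose r * 2 ^ r) F S := by
  classical
  let P := Σ D : Finset.powersetCard r (Finset.univ : Finset (Fin j)), (D.1 → Bool)
  have hP : Fintype.card P = j.choose r * 2 ^ r := by
    rw [Fintype.card_sigma, Finset.sum_congr rfl (g := fun _ => 2 ^ r)]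
    · simp
    · intro D _
      simp [(Finset.mem_powersetCard.mp D.2).2]
  let e : P ≃ Fin (j.choose r * 2 ^ r) := Fintype.equivFinOfCardEq hP
  obtain ⟨w⟩ : Nonempty (Fin n ↪ (Fin j → Bool)) :=
    Function.Embedding.nonempty_of_card_le (by simpa using hn)
  let S : Fin n → Finset (Fin (j.choose r * 2 ^ r)) := fun i =>
    {a | ∀ c : (e.symm a).1.1, w i c = (e.symm a).2 c}
  obtain ⟨F, hF⟩ := exists_isThresholdSystem_of_coverFree (k := r + 1) (S := S) <| by
    intro i H hH hi hsub
    obtain ⟨D, hD, hsep⟩ := exists_card_eq_forall_exists_ne (by simpa using hr) (w i) (H.map w)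
      (by rw [Finset.card_map]; omega) (by simpa using hi)
    let p : P := ⟨⟨D, Finset.mem_powersetCard.mpr ⟨Finset.subset_univ D, hD⟩⟩, fun c => w i c⟩
    have hmem : ∀ h, e p ∈ S h ↔ ∀ c : D, w h c = w i c := by
      intro h
      simp only [S, Finset.mem_filter_univ]
      rw [e.symm_apply_apply]
    obtain ⟨h, hh, hp⟩ := Finset.mem_biUnion.mp (hsub ((hmem i).mpr fun _ => rfl))
    obtain ⟨c, hc, hne⟩ := hsep (w h) (Finset.mem_map_of_mem w hh)
    exact hne ((hmem h).mp hp ⟨c, hc⟩)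
  exact ⟨F, S, hF⟩

/-- Recursive construction: for each fixed threshold `k ≥ 2` and any
`ε > 0`, for all large enough `n` there is a `k`-out-of-`n` threshold
padlock system with at most `(2^(k-1)/(k-1)! + ε) (log₂ n)^(k-1)` padlocks;
hence `ℓ(k, n) = O((log n)^(k-1))`. -/
theorem recursive_threshold_log_power (k : ℕ) (hk : 2 ≤ k) (ε : ℝ)
    (hε : 0 < ε) :
    ∃ N : ℕ, ∀ n : ℕ, N ≤ n →
      ∃ t : ℕ,
        t ≤ ⌊((2 : ℝ) ^ (k - 1) / (Nat.factorial (k - 1)) + ε) *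
              (Real.logb 2 n) ^ (k - 1)⌋₊ ∧
        ∃ (F : Finset (Fin t) → Prop) (S : Fin n → Finset (Fin t)),
          IsThresholdSystem k n t F S := by
  obtain ⟨r, rfl⟩ : ∃ r, k = r + 1 := ⟨k - 1, by omega⟩
  simp only [Nat.add_sub_cancel]
  have hlog : Filter.Tendsto (fun n : ℕ => Real.logb 2 n) Filter.atTop Filter.atTop :=
    (Real.tendsto_logb_atTop one_lt_two).comp tendsto_natCast_atTop_atTop
  obtain ⟨N, hN⟩ := Filter.eventually_atTop.mp
    ((hlog.eventually (eventually_mul_add_one_pow_le ((2 : ℝ) ^ r / r.factorial) ε hε r)).and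
      ((hlog.eventually_ge_atTop (r : ℝ)).and (hlog.eventually_ge_atTop 0)))
  refine ⟨N, fun n hn => ?_⟩
  obtain ⟨hpow, hrn, h0⟩ := hN n hn
  have hj : (⌈Real.logb 2 n⌉₊ : ℝ) ≤ Real.logb 2 n + 1 := (Nat.ceil_lt_add_one h0).le
  have hr : r ≤ ⌈Real.logb 2 n⌉₊ := by exact_mod_cast hrn.trans (Nat.le_ceil _)
  have hn2 : n ≤ 2 ^ ⌈Real.logb 2 n⌉₊ := by
    have := Real.natCeil_logb_natCast 2 n
    push_cast at this
    rw [this]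
    exact Nat.le_pow_clog one_lt_two n
  refine ⟨_, Nat.le_floor ?_, exists_isThresholdSystem_choose hr hn2⟩
  refine le_trans ?_ hpow
  push_cast
  calc ((⌈Real.logb 2 n⌉₊.choose r : ℕ) : ℝ) * 2 ^ r
      ≤ (⌈Real.logb 2 n⌉₊ : ℝ) ^ r / r.factorial * 2 ^ r := by
        gcongr
        exact Nat.choose_le_pow_div r _
    _ = 2 ^ r / r.factorial * (⌈Real.logb 2 n⌉₊ : ℝ) ^ r := by ring
    _ ≤ 2 ^ r / r.factorial * (Real.logb 2 n + 1) ^ r := by gcongr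
end
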